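/- (Estimate (5.23), mean square of R₁₁) Fix an integer l ≥ 1 and an irrational θ > 0 of finite approximation type γ ≥ 1. For every ε > 0 there exist C > 0 and T₀ ≥ 3 such that for all T ≥ T₀, setting H = T²: |∫_T^{2T} R₁₁(x,H)² dx − (2^{3−2l}·C_{l,θ}/(π²·((l−1)!)²))·∫_T^{2T} x^{2l−1/2} dx| ≤ C·T^{2l + 1/2 − 1/(2(1+γ)) + ε}. -/

import Mathlib

open Finset

/-- An irrational real `α` is of finite approximation type `γ` if `γ ≥ 1` and for every
`ε > 0` there is `c(ε) > 0` with `|α − p/q| ≥ c(ε)·q^{−γ−1−ε}` for all integers `p` and all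
positive integers `q`. -/
def IsApproxType (α γ : ℝ) : Prop :=
  1 ≤ γ ∧ ∀ ε : ℝ, 0 < ε → ∃ c : ℝ, 0 < c ∧
    ∀ p : ℤ, ∀ q : ℕ, 0 < q → |α - (p : ℝ) / q| ≥ c * (q : ℝ) ^ (-γ - 1 - ε)

/-- `R₁(x,H) = (2^{2−l}/((l−1)!·π)) · Σ_{1≤h≤H} ((−1)^{lh}/h) ·
Σ_{1≤m≤√(x/θ)} m·(x − θm²)^{l−1}·sin(2πh(x/(2m) − θm/2))`. -/
noncomputable def R1 (l : ℕ) (θ : ℝ) (x H : ℝ) : ℝ :=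
  ((2 : ℝ) ^ ((2 : ℤ) - l) / ((l - 1).factorial * Real.pi)) *
    ∑ h ∈ Finset.Icc 1 ⌊H⌋₊, ((-1 : ℝ) ^ (l * h) / h) *
      ∑ m ∈ Finset.Icc 1 ⌊Real.sqrt (x / θ)⌋₊,
        (m : ℝ) * (x - θ * m ^ 2) ^ (l - 1) *
          Real.sin (2 * Real.pi * h * (x / (2 * m) - θ * m / 2))

/-- `u(h,r) = (−1)^{lh}·h^{−1/4}·(2r − θh)^{−5/4}·(1 − θh/(2r − θh))^{l−1}`. -/
noncomputable def uCoef (l : ℕ) (θ : ℝ) (h r : ℕ) : ℝ :=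
  (-1 : ℝ) ^ (l * h) * (h : ℝ) ^ (-(1 : ℝ) / 4) *
    (2 * (r : ℝ) - θ * h) ^ (-(5 : ℝ) / 4) *
    (1 - θ * h / (2 * (r : ℝ) - θ * h)) ^ (l - 1)

/-- `J = ⌊(log T − log log T)/(2 log 2)⌋`. -/
noncomputable def Jdef (T : ℝ) : ℕ :=
  ⌊(Real.log T - Real.log (Real.log T)) / (2 * Real.log 2)⌋₊

/-- `R₁₁(x,H) = (2^{2−l}/((l−1)!·π))·x^{l−1/4}·Σ_{1≤h≤H}
Σ_{θh < r ≤ θh(2^{2J+1}+1/2)} u(h,r)·cos(2π√(x·h(2r − θh)) − π/4)`, with `J = Jdef T`. -/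
noncomputable def R11 (l : ℕ) (θ : ℝ) (T x H : ℝ) : ℝ :=
  ((2 : ℝ) ^ ((2 : ℤ) - l) / ((l - 1).factorial * Real.pi)) * x ^ ((l : ℝ) - 1 / 4) *
    ∑ h ∈ Finset.Icc 1 ⌊H⌋₊,
      ∑ r ∈ Finset.Ioc ⌊θ * h⌋₊ ⌊θ * h * (2 ^ (2 * Jdef T + 1) + 1 / 2)⌋₊,
        uCoef l θ h r *
          Real.cos (2 * Real.pi * Real.sqrt (x * h * (2 * (r : ℝ) - θ * h)) - Real.pi / 4)

open Classical in
/-- `C_{l,θ} = Σ_{h=1}^∞ Σ_{r > θh} (1 − θh/(2r − θh))^{2l−2}·h^{−1/2}·(2r − θh)^{−5/2}`. -/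
noncomputable def Cconst (l : ℕ) (θ : ℝ) : ℝ :=
  ∑' p : ℕ × ℕ,
    if 1 ≤ p.1 ∧ 1 ≤ p.2 ∧ θ * p.1 < (p.2 : ℝ) then
      (1 - θ * p.1 / (2 * (p.2 : ℝ) - θ * p.1)) ^ (2 * l - 2) *
        (p.1 : ℝ) ^ (-(1 : ℝ) / 2) * (2 * (p.2 : ℝ) - θ * p.1) ^ (-(5 : ℝ) / 2)
    else 0

lemma sum_inv_le_of_separated {ι : Type*} (s : Finset ι) (f : ι → ℝ) {N : ℝ} (hN1 : 1 ≤ N)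
    (h1 : ∀ i ∈ s, 1 ≤ f i) (hN : ∀ i ∈ s, f i ≤ N)
    (hsep : ∀ i ∈ s, ∀ j ∈ s, i ≠ j → 1 ≤ |f i - f j|) :
    ∑ i ∈ s, (f i)⁻¹ ≤ 1 + Real.log N := by
  have hinj : Set.InjOn (fun i => ⌊f i⌋₊) s := by
    intro i hi j hj hij
    by_contra hne
    have h := hsep i hi j hj hne
    have hij' : ⌊f i⌋₊ = ⌊f j⌋₊ := hij
    have a1 := Nat.floor_le (zero_le_one.trans (h1 i hi))
    have a2 := Nat.lt_floor_add_one (f i)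
    have b1 := Nat.floor_le (zero_le_one.trans (h1 j hj))
    have b2 := Nat.lt_floor_add_one (f j)
    rw [hij'] at a1 a2
    have : |f i - f j| < 1 := by rw [abs_lt]; constructor <;> linarith
    linarith
  calc ∑ i ∈ s, (f i)⁻¹ ≤ ∑ i ∈ s, ((⌊f i⌋₊ : ℕ) : ℝ)⁻¹ := by
        refine sum_le_sum fun i hi => ?_
        have hpos : 0 < ⌊f i⌋₊ := Nat.floor_pos.mpr (h1 i hi)
        have := Nat.floor_le (zero_le_one.trans (h1 i hi))
        gcongr
    _ = ∑ n ∈ s.image (fun i => ⌊f i⌋₊), ((n : ℕ) : ℝ)⁻¹ := by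
        rw [sum_image hinj]
    _ ≤ ∑ n ∈ Icc 1 ⌊N⌋₊, ((n : ℕ) : ℝ)⁻¹ := by
        refine sum_le_sum_of_subset_of_nonneg ?_ fun _ _ _ => by positivity
        intro n hn
        obtain ⟨i, hi, rfl⟩ := mem_image.mp hn
        exact mem_Icc.mpr ⟨Nat.floor_pos.mpr (h1 i hi), Nat.floor_le_floor (hN i hi)⟩
    _ ≤ 1 + Real.log N := by
        have := harmonic_floor_le_one_add_log N hN1
        rw [harmonic_eq_sum_Icc] at this
        push_cast at this
        exact this

lemma sum_Icc_inv_le {n : ℕ} {N : ℝ} (hN1 : 1 ≤ N) (hn : (n : ℝ) ≤ N) :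
    ∑ j ∈ Icc 1 n, (j : ℝ)⁻¹ ≤ 1 + Real.log N := by
  refine sum_inv_le_of_separated _ (fun j : ℕ => (j : ℝ)) hN1 ?_ ?_ ?_
  · intro i hi
    exact_mod_cast (mem_Icc.mp hi).1
  · intro i hi
    exact le_trans (by exact_mod_cast (mem_Icc.mp hi).2) hn
  · intro i _ j _ hij
    have : (i : ℤ) - j ≠ 0 := by omega
    have := Int.one_le_abs this
    exact_mod_cast this

/-- Solutions of a linear equation `h r - h' r' = n` are spread along a line, so the reciprocals
`1 / (r r')` of those with `r, r' ≥ c h` sum to `O(gcd(h, h') / h ^ 2)` up to a logarithm. -/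
lemma sum_inv_mul_le_of_linear_aux {ι : Type*} (s : Finset ι) (r r' : ι → ℕ) {h h' : ℕ} {n : ℤ}
    (hh : 0 < h) {c N : ℝ} (hc : 0 < c) (hc1 : c ≤ 1) (hN1 : 1 ≤ N)
    (hinj : ∀ x ∈ s, ∀ y ∈ s, r x = r y → r' x = r' y → x = y)
    (hn : ∀ x ∈ s, (h * r x - h' * r' x : ℤ) = n)
    (hr : ∀ x ∈ s, c * h ≤ r x) (hr' : ∀ x ∈ s, c * h ≤ r' x) (hN : ∀ x ∈ s, (r' x : ℝ) ≤ c * N) :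
    ∑ x ∈ s, ((r x : ℝ) * r' x)⁻¹ ≤ (Nat.gcd h h') / (c ^ 2 * h ^ 2) * (1 + Real.log N) := by
  set g := Nat.gcd h h' with hg
  have hgpos : 0 < g := Nat.gcd_pos_of_pos_left _ hh
  obtain ⟨a, b, hab, ha, hb⟩ := Nat.exists_coprime h h'
  rw [← hg] at ha hb
  have hapos : 0 < a := by
    rcases Nat.eq_zero_or_pos a with h0 | h0
    · rw [h0] at ha; omega
    · exact h0
  have ha1 : (1 : ℝ) ≤ a := by exact_mod_cast hapos
  have hg1 : (1 : ℝ) ≤ g := by exact_mod_cast hgpos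
  have hhR : (h : ℝ) = a * g := by rw [ha]; push_cast; ring
  have key : ∑ x ∈ s, ((r' x : ℝ) / (c * a))⁻¹ ≤ 1 + Real.log N := by
    refine sum_inv_le_of_separated s _ hN1 ?_ ?_ ?_
    · intro x hx
      rw [le_div_iff₀ (by positivity), one_mul]
      refine le_trans ?_ (hr' x hx)
      rw [hhR]
      have : (a : ℝ) ≤ a * g := le_mul_of_one_le_right (by positivity) hg1
      gcongr
    · intro x hx
      rw [div_le_iff₀ (by positivity)]
      refine (hN x hx).trans ?_
      have : c * N ≤ c * N * a := le_mul_of_one_le_right (by positivity) ha1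
      linarith
    · intro x hx y hy hxy
      have e : (h : ℤ) * (r x - r y) = h' * (r' x - r' y) := by
        have := hn x hx; have := hn y hy; linarith
      have hgz : (g : ℤ) ≠ 0 := by exact_mod_cast hgpos.ne'
      have e2 : (a : ℤ) * (r x - r y) = b * (r' x - r' y) := by
        rw [ha, hb] at e
        push_cast at e
        refine mul_right_cancel₀ hgz ?_
        linarith
      have hne : (r' x : ℤ) - r' y ≠ 0 := by
        intro h0
        rw [h0, mul_zero] at e2
        have haz : (a : ℤ) ≠ 0 := by exact_mod_cast hapos.ne'
        have h1 := (mul_eq_zero.mp e2).resolve_left haz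
        exact hxy (hinj x hx y hy (by omega) (by omega))
      have hdvd : (a : ℤ) ∣ (r' x - r' y : ℤ) := by
        have : (a : ℤ) ∣ b * (r' x - r' y : ℤ) := ⟨_, e2.symm⟩
        exact (Nat.isCoprime_iff_coprime.mpr hab).dvd_of_dvd_mul_left this
      have hle : (a : ℤ) ≤ |(r' x : ℤ) - r' y| :=
        Int.le_of_dvd (abs_pos.mpr hne) ((dvd_abs _ _).mpr hdvd)
      have hle' : (a : ℝ) ≤ |(r' x : ℝ) - r' y| := by exact_mod_cast hle
      rw [← sub_div, abs_div, abs_of_pos (show 0 < c * a by positivity),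
        le_div_iff₀ (by positivity)]
      nlinarith
  calc ∑ x ∈ s, ((r x : ℝ) * r' x)⁻¹
      ≤ ∑ x ∈ s, (g / (c ^ 2 * h ^ 2)) * ((r' x : ℝ) / (c * a))⁻¹ := by
        refine sum_le_sum fun x hx => ?_
        have h1 := hr x hx
        have h2 := hr' x hx
        have hp : (0 : ℝ) < c * h := by positivity
        have hrx : (0 : ℝ) < r x := hp.trans_le h1
        have hrx' : (0 : ℝ) < r' x := hp.trans_le h2
        have : (g / (c ^ 2 * h ^ 2)) * ((r' x : ℝ) / (c * a))⁻¹ = (c * h * r' x)⁻¹ := by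
          rw [hhR]; field_simp
        rw [this]
        gcongr
    _ = g / (c ^ 2 * h ^ 2) * ∑ x ∈ s, ((r' x : ℝ) / (c * a))⁻¹ := by rw [mul_sum]
    _ ≤ _ := by gcongr

lemma sum_inv_mul_le_of_linear {ι : Type*} (s : Finset ι) (r r' : ι → ℕ) {h h' : ℕ} {n : ℤ}
    (hh : 0 < h) (hh' : 0 < h') {c N : ℝ} (hc : 0 < c) (hc1 : c ≤ 1) (hN1 : 1 ≤ N)
    (hinj : ∀ x ∈ s, ∀ y ∈ s, r x = r y → r' x = r' y → x = y)
    (hn : ∀ x ∈ s, (h * r x - h' * r' x : ℤ) = n)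
    (hr : ∀ x ∈ s, c * (max h h' : ℕ) ≤ r x) (hr' : ∀ x ∈ s, c * (max h h' : ℕ) ≤ r' x)
    (hN : ∀ x ∈ s, (r x : ℝ) ≤ c * N) (hN' : ∀ x ∈ s, (r' x : ℝ) ≤ c * N) :
    ∑ x ∈ s, ((r x : ℝ) * r' x)⁻¹ ≤
      (Nat.gcd h h') / (c ^ 2 * ((max h h' : ℕ) : ℝ) ^ 2) * (1 + Real.log N) := by
  rcases le_total h' h with hle | hle
  · have e : max h h' = h := max_eq_left hle
    rw [e] at hr hr' ⊢
    exact sum_inv_mul_le_of_linear_aux s r r' hh hc hc1 hN1 hinj hn hr hr' hN'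
  · have e : max h h' = h' := max_eq_right hle
    rw [e] at hr hr' ⊢
    have := sum_inv_mul_le_of_linear_aux s r' r (h' := h) (n := -n) hh' hc hc1 hN1
      (fun x hx y hy h1 h2 => hinj x hx y hy h2 h1)
      (fun x hx => by rw [← hn x hx]; ring) hr' hr hN
    rw [Nat.gcd_comm h' h] at this
    simpa only [mul_comm] using this

lemma IsApproxType.exists_mul_sub_ge {θ γ : ℝ} (h : IsApproxType θ γ) {η : ℝ} (hη : 0 < η) :
    ∃ c : ℝ, 0 < c ∧ ∀ p : ℤ, ∀ q : ℕ, 0 < q → c * (q : ℝ) ^ (-(γ + η)) ≤ |θ * q - p| := by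
  obtain ⟨c, hc, H⟩ := h.2 η hη
  refine ⟨c, hc, fun p q hq => ?_⟩
  have hq' : (0 : ℝ) < q := by exact_mod_cast hq
  have h1 := H p q hq
  have e : θ * q - p = (θ - p / q) * q := by field_simp
  rw [e, abs_mul, abs_of_pos hq']
  have e2 : (q : ℝ) ^ (-(γ + η)) = (q : ℝ) ^ (-γ - 1 - η) * q := by
    rw [← Real.rpow_add_one hq'.ne']; congr 1; ring
  rw [e2, ← mul_assoc]
  gcongr

/-- The distance from `x` to the nearest integer. -/
noncomputable def distInt (x : ℝ) : ℝ := |x - round x|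

lemma exists_close_pair {S : ℕ} {G : Finset ℕ} (hG : G ⊆ Icc 1 S) (h2 : 2 ≤ #G) :
    ∃ x ∈ G, ∃ y ∈ G, x < y ∧ (y - x) * #G ≤ 2 * S := by
  have hS : 0 < S := by
    by_contra h0
    have : S = 0 := by omega
    subst this
    have := card_le_card hG
    simp at this
    simp [this] at h2
  have hmaps : Set.MapsTo (fun x => (x - 1) * (#G - 1) / S) G (range (#G - 1)) := by
    intro x hx
    have hx' := mem_Icc.mp (hG hx)
    simp only [coe_range, Set.mem_Iio]
    rw [Nat.div_lt_iff_lt_mul hS, mul_comm]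
    exact Nat.mul_lt_mul_of_pos_left (by omega) (by omega)
  obtain ⟨x, hx, y, hy, hne, hxy⟩ := exists_ne_map_eq_of_card_lt_of_maps_to
    (by rw [card_range]; omega) hmaps
  have main : ∀ x ∈ G, ∀ y ∈ G, x < y → (x - 1) * (#G - 1) / S = (y - 1) * (#G - 1) / S →
      (y - x) * #G ≤ 2 * S := by
    intro x hx y hy hlt heq
    have hx1 := (mem_Icc.mp (hG hx)).1
    have a := Nat.div_add_mod ((x - 1) * (#G - 1)) S
    have b := Nat.div_add_mod ((y - 1) * (#G - 1)) S
    have b' := Nat.mod_lt ((y - 1) * (#G - 1)) hS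
    rw [heq] at a
    obtain ⟨k, hk⟩ : ∃ k, #G = k + 2 := ⟨#G - 2, by omega⟩
    obtain ⟨d, hd⟩ : ∃ d, y = x + d := ⟨y - x, by omega⟩
    obtain ⟨z, hz⟩ : ∃ z, x = z + 1 := ⟨x - 1, by omega⟩
    subst hd hz
    have e1 : z + 1 + d - (z + 1) = d := by omega
    have e2 : z + 1 + d - 1 = z + d := by omega
    have e3 : z + 1 - 1 = z := by omega
    have e4 : k + 2 - 1 = k + 1 := by omega
    rw [hk, e2, e4] at b b'
    rw [hk, e2, e3, e4] at a
    rw [hk, e1]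
    have e5 : (z + d) * (k + 1) = z * (k + 1) + d * (k + 1) := by ring
    have e6 : d * (k + 1) < S := by linarith [Nat.zero_le (z * (k + 1) % S)]
    nlinarith
  rcases lt_or_gt_of_ne hne with h | h
  · exact ⟨x, hx, y, hy, h, main x hx y hy h hxy⟩
  · exact ⟨y, hy, x, hx, h, main y hy x hx h hxy.symm⟩

section Diophantine

variable {θ a c : ℝ}

lemma exists_distInt_ge (ha : 0 < a) (hc : 0 < c)
    (H : ∀ p : ℤ, ∀ q : ℕ, 0 < q → c * (q : ℝ) ^ (-a) ≤ |θ * q - p|)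
    {D S : ℕ} (hD : 0 < D) {G : Finset ℕ} (hG : G ⊆ Icc 1 S) (hne : G.Nonempty) :
    ∃ σ ∈ G, c / 2 * (2 * D * (S / #G) : ℝ) ^ (-a) ≤ distInt (θ * (D * σ : ℕ)) := by
  have hcard : 0 < #G := hne.card_pos
  have hDR : (1 : ℝ) ≤ D := by exact_mod_cast hD
  rcases Nat.lt_or_ge (#G) 2 with h1 | h2
  · obtain ⟨σ, hσ⟩ := hne
    have hσ' := mem_Icc.mp (hG hσ)
    have hc1 : #G = 1 := by omega
    refine ⟨σ, hσ, ?_⟩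
    have h := H (round (θ * (D * σ : ℕ))) (D * σ) (Nat.mul_pos hD hσ'.1)
    refine le_trans ?_ h
    have hσ1 : (1 : ℝ) ≤ σ := by exact_mod_cast hσ'.1
    have hσS : (σ : ℝ) ≤ S := by exact_mod_cast hσ'.2
    rw [hc1]
    have hpos : (0 : ℝ) < ((D * σ : ℕ) : ℝ) := by push_cast; positivity
    have : (2 * D * (S / (1 : ℕ)) : ℝ) ^ (-a) ≤ ((D * σ : ℕ) : ℝ) ^ (-a) := by
      refine Real.rpow_le_rpow_of_nonpos hpos ?_ (by linarith)
      push_cast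
      rw [div_one]
      nlinarith
    have h0 : (0 : ℝ) ≤ (2 * D * (S / (1 : ℕ)) : ℝ) ^ (-a) := by positivity
    nlinarith
  · obtain ⟨x, hx, y, hy, hlt, hd⟩ := exists_close_pair hG h2
    have h := H (round (θ * (D * y : ℕ)) - round (θ * (D * x : ℕ))) (D * (y - x))
      (Nat.mul_pos hD (by omega))
    have hle : (((D * (y - x) : ℕ)) : ℝ) ≤ 2 * D * (S / #G) := by
      have : ((y - x : ℕ) : ℝ) * #G ≤ 2 * S := by exact_mod_cast hd
      have : ((y - x : ℕ) : ℝ) ≤ 2 * S / #G := by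
        rw [le_div_iff₀ (by exact_mod_cast hcard)]; exact this
      rw [Nat.cast_mul]
      calc (D : ℝ) * ((y - x : ℕ) : ℝ) ≤ D * (2 * S / #G) := by gcongr
        _ = _ := by ring
    have hpos : (0 : ℝ) < ((D * (y - x) : ℕ) : ℝ) := by
      exact_mod_cast Nat.mul_pos hD (by omega)
    have hmono := Real.rpow_le_rpow_of_nonpos hpos hle (by linarith : -a ≤ 0)
    have h3 : c * (2 * D * (S / #G) : ℝ) ^ (-a) ≤
        distInt (θ * (D * y : ℕ)) + distInt (θ * (D * x : ℕ)) := by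
      refine (mul_le_mul_of_nonneg_left hmono hc.le).trans (h.trans ?_)
      unfold distInt
      rw [Nat.cast_mul D (y - x), Nat.cast_sub hlt.le]
      push_cast
      have : θ * ((D : ℝ) * (y - x)) - (round (θ * ((D : ℝ) * y)) - round (θ * ((D : ℝ) * x))) =
        (θ * (D * y) - round (θ * ((D : ℝ) * y))) - (θ * (D * x) - round (θ * ((D : ℝ) * x))) := by
          ring
      rw [this]
      exact abs_sub _ _
    rcases le_total (distInt (θ * (D * x : ℕ))) (distInt (θ * (D * y : ℕ))) with h4 | h4
    · exact ⟨y, hy, by linarith⟩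
    · exact ⟨x, hx, by linarith⟩

lemma distInt_pos (hc : 0 < c)
    (H : ∀ p : ℤ, ∀ q : ℕ, 0 < q → c * (q : ℝ) ^ (-a) ≤ |θ * q - p|) {q : ℕ} (hq : 0 < q) :
    0 < distInt (θ * q) := by
  have hq' : (0 : ℝ) < q := by exact_mod_cast hq
  exact lt_of_lt_of_le (by positivity) (H (round (θ * q)) q hq)

lemma sum_distInt_rpow_neg_le (ha : 0 < a) (hc : 0 < c)
    (H : ∀ p : ℤ, ∀ q : ℕ, 0 < q → c * (q : ℝ) ^ (-a) ≤ |θ * q - p|)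
    {s : ℝ} (hs : 0 < s) (has : a * s ≤ 1) {D S : ℕ} (hD : 0 < D) (n : ℕ) :
    ∀ G : Finset ℕ, G ⊆ Icc 1 S → #G = n →
      ∑ σ ∈ G, distInt (θ * (D * σ : ℕ)) ^ (-s) ≤
        (c / 2) ^ (-s) * 2 * (D : ℝ) ^ (a * s) * S * ∑ j ∈ Icc 1 n, (j : ℝ)⁻¹ := by
  induction n with
  | zero =>
    intro G _ h0
    rw [card_eq_zero.mp h0]
    simp
  | succ n ih =>
    intro G hG hn
    have hne : G.Nonempty := card_pos.mp (by omega)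
    obtain ⟨σ, hσ, hge⟩ := exists_distInt_ge ha hc H hD hG hne
    rw [← add_sum_erase G _ hσ]
    have h1 := ih (G.erase σ) ((erase_subset _ _).trans hG) (by rw [card_erase_of_mem hσ]; omega)
    rw [sum_Icc_succ_top (by omega), mul_add]
    have hnS : n + 1 ≤ S := by
      have := card_le_card hG
      rw [hn, Nat.card_Icc] at this
      omega
    have hnS' : ((n + 1 : ℕ) : ℝ) ≤ S := by exact_mod_cast hnS
    have hDR : (0 : ℝ) < D := by exact_mod_cast hD
    have hn0 : (0 : ℝ) < ((n + 1 : ℕ) : ℝ) := by positivity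
    have hS0 : (0 : ℝ) < S := hn0.trans_le hnS'
    have h2 : distInt (θ * (D * σ : ℕ)) ^ (-s) ≤
        (c / 2) ^ (-s) * 2 * (D : ℝ) ^ (a * s) * S * ((n + 1 : ℕ) : ℝ)⁻¹ := by
      rw [hn] at hge
      have hx1 : 1 ≤ (S : ℝ) / ((n + 1 : ℕ) : ℝ) := (one_le_div hn0).mpr hnS'
      have has0 : 0 < a * s := mul_pos ha hs
      calc distInt (θ * (D * σ : ℕ)) ^ (-s)
          ≤ (c / 2 * (2 * D * (S / ((n + 1 : ℕ) : ℝ)) : ℝ) ^ (-a)) ^ (-s) :=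
            Real.rpow_le_rpow_of_nonpos (by positivity) hge (by linarith)
        _ = (c / 2) ^ (-s) * (2 ^ (a * s) * (D : ℝ) ^ (a * s) *
              (S / ((n + 1 : ℕ) : ℝ)) ^ (a * s)) := by
            rw [Real.mul_rpow (by positivity) (by positivity), ← Real.rpow_mul (by positivity),
              Real.mul_rpow (by positivity) (by positivity),
              Real.mul_rpow (by positivity) (by positivity), neg_mul_neg]
        _ ≤ (c / 2) ^ (-s) * (2 ^ (1 : ℝ) * (D : ℝ) ^ (a * s) *
              (S / ((n + 1 : ℕ) : ℝ)) ^ (1 : ℝ)) := by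
            gcongr
            norm_num
        _ = _ := by rw [Real.rpow_one, Real.rpow_one]; ring
    linarith

lemma sum_div_le_of_partial_sums (f : ℕ → ℝ) {B : ℝ} (n : ℕ)
    (hF : ∀ S : ℕ, S ≤ n → ∑ σ ∈ Icc 1 S, f σ ≤ B * S) :
    ∑ σ ∈ Icc 1 n, f σ / σ ≤ B * ∑ j ∈ Icc 1 n, (j : ℝ)⁻¹ := by
  rcases Nat.eq_zero_or_pos n with h0 | hpos
  · subst h0; simp
  have key : ∀ m : ℕ, 1 ≤ m → m ≤ n → ∑ σ ∈ Icc 1 m, f σ / σ ≤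
      (∑ σ ∈ Icc 1 m, f σ) / m - B + B * ∑ j ∈ Icc 1 m, (j : ℝ)⁻¹ := by
    intro m hm
    induction m, hm using Nat.le_induction with
    | base => intro _; simp
    | succ m hm ih =>
      intro hmn
      have h1 := ih (by omega)
      have h2 := hF m (by omega)
      rw [sum_Icc_succ_top (by omega), sum_Icc_succ_top (by omega), sum_Icc_succ_top (by omega)]
      set F := ∑ σ ∈ Icc 1 m, f σ
      have hm0 : (0 : ℝ) < m := by exact_mod_cast hm
      have h3 : F / m ≤ F / ((m + 1 : ℕ) : ℝ) + B * ((m + 1 : ℕ) : ℝ)⁻¹ := by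
        push_cast
        rw [← div_eq_mul_inv, ← add_div, div_le_div_iff₀ hm0 (by positivity)]
        nlinarith
      rw [add_div, mul_add]
      linarith
  have h1 := key n hpos le_rfl
  have h2 := hF n le_rfl
  have hn0 : (0 : ℝ) < n := by exact_mod_cast hpos
  have h3 : (∑ σ ∈ Icc 1 n, f σ) / n ≤ B := by rw [div_le_iff₀ hn0]; exact h2
  linarith

lemma sum_distInt_rpow_neg_div_le (ha : 0 < a) (hc : 0 < c)
    (H : ∀ p : ℤ, ∀ q : ℕ, 0 < q → c * (q : ℝ) ^ (-a) ≤ |θ * q - p|)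
    {s : ℝ} (hs : 0 < s) (has : a * s ≤ 1) {D n : ℕ} (hD : 0 < D) {N : ℝ} (hN1 : 1 ≤ N)
    (hn : (n : ℝ) ≤ N) :
    ∑ σ ∈ Icc 1 n, distInt (θ * (D * σ : ℕ)) ^ (-s) / σ ≤
      (c / 2) ^ (-s) * 2 * (D : ℝ) ^ (a * s) * (1 + Real.log N) ^ 2 := by
  have hL : 0 ≤ Real.log N := Real.log_nonneg hN1
  have h1 := sum_div_le_of_partial_sums (fun σ => distInt (θ * (D * σ : ℕ)) ^ (-s))
    (B := (c / 2) ^ (-s) * 2 * (D : ℝ) ^ (a * s) * (1 + Real.log N)) n (by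
      intro S hS
      refine (sum_distInt_rpow_neg_le ha hc H hs has hD _ (Icc 1 S) Subset.rfl rfl).trans ?_
      have hS' : (S : ℝ) ≤ N := le_trans (by exact_mod_cast hS) hn
      have := sum_Icc_inv_le (n := S) hN1 hS'
      rw [Nat.card_Icc, Nat.add_sub_cancel]
      calc (c / 2) ^ (-s) * 2 * (D : ℝ) ^ (a * s) * S * ∑ j ∈ Icc 1 S, (j : ℝ)⁻¹
          ≤ (c / 2) ^ (-s) * 2 * (D : ℝ) ^ (a * s) * S * (1 + Real.log N) := by gcongr
        _ = _ := by ring)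
  refine h1.trans ?_
  have := sum_Icc_inv_le (n := n) hN1 hn
  calc _ ≤ (c / 2) ^ (-s) * 2 * (D : ℝ) ^ (a * s) * (1 + Real.log N) * (1 + Real.log N) := by
        gcongr
    _ = _ := by ring

lemma sum_gcd_distInt_le (ha : 0 < a) (hc : 0 < c)
    (H : ∀ p : ℤ, ∀ q : ℕ, 0 < q → c * (q : ℝ) ^ (-a) ≤ |θ * q - p|)
    {s κ : ℝ} (hs : 0 < s) (hs1 : s ≤ 1) (has : a * s ≤ 1) (hκ : 0 ≤ κ) (hsκ : s + a * s = 1 + κ)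
    {n : ℕ} {N : ℝ} (hN1 : 1 ≤ N) (hn : 2 * (n : ℝ) ≤ N) :
    ∑ x ∈ (Icc 1 n ×ˢ Icc 1 n).filter (fun x : ℕ × ℕ => x.2 < x.1),
      ((Nat.gcd x.1 x.2 : ℕ) : ℝ) ^ (1 - s) * (x.1 : ℝ) ^ (-3 + s) *
        distInt (θ * ((x.1 - x.2) * (x.1 + x.2) / Nat.gcd x.1 x.2 : ℕ)) ^ (-s) ≤
      16 * (c / 2) ^ (-s) * (1 + Real.log N) ^ 4 * N ^ κ := by
  have hL : 0 ≤ Real.log N := Real.log_nonneg hN1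
  set m := 2 * n with hm
  have hmN : (m : ℝ) ≤ N := by rw [hm]; push_cast; exact hn
  let F : (ℕ × ℕ) × ℕ → ℝ := fun y => 8 * (y.1.1 : ℝ) ^ (-2 : ℝ) * (y.1.2 : ℝ) ^ (-2 + s) *
    (distInt (θ * ((y.1.1 * y.1.2) * y.2 : ℕ)) ^ (-s) / y.2)
  let φ : ℕ × ℕ → (ℕ × ℕ) × ℕ := fun x =>
    ((Nat.gcd x.1 x.2, (x.1 - x.2) / Nat.gcd x.1 x.2), (x.1 + x.2) / Nat.gcd x.1 x.2)
  set P := (Icc 1 n ×ˢ Icc 1 n).filter (fun x : ℕ × ℕ => x.2 < x.1)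
  have param : ∀ x ∈ P, ∃ g u v : ℕ, 0 < g ∧ 0 < v ∧ v < u ∧ Nat.gcd x.1 x.2 = g ∧ x.1 = u * g ∧
      x.2 = v * g ∧ x.1 ≤ n := by
    intro x hx
    obtain ⟨hx1, hlt⟩ := mem_filter.mp hx
    obtain ⟨h1, h2⟩ := mem_product.mp hx1
    obtain ⟨h1a, h1b⟩ := mem_Icc.mp h1
    obtain ⟨h2a, h2b⟩ := mem_Icc.mp h2
    have hg : 0 < Nat.gcd x.1 x.2 := Nat.gcd_pos_of_pos_left _ (by omega)
    obtain ⟨u, v, -, hu, hv⟩ := Nat.exists_coprime x.1 x.2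
    refine ⟨_, u, v, hg, ?_, ?_, rfl, hu, hv, h1b⟩
    · rcases Nat.eq_zero_or_pos v with h0 | h0
      · rw [h0] at hv; omega
      · exact h0
    · have hlt' : v * Nat.gcd x.1 x.2 < u * Nat.gcd x.1 x.2 := by rw [← hu, ← hv]; exact hlt
      exact lt_of_mul_lt_mul_right hlt' (Nat.zero_le _)
  have φeq : ∀ {x : ℕ × ℕ} {g u v : ℕ}, 0 < g → v < u → Nat.gcd x.1 x.2 = g → x.1 = u * g →
      x.2 = v * g → φ x = ((g, u - v), u + v) := by
    intro x g u v hg hvu h1 h2 h3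
    simp only [φ]
    rw [h1, h2, h3, ← Nat.sub_mul, ← Nat.add_mul, Nat.mul_div_cancel _ hg, Nat.mul_div_cancel _ hg]
  have hφinj : Set.InjOn φ P := by
    intro x hx y hy hxy
    obtain ⟨g, u, v, hg, hv, hvu, h1, h2, h3, -⟩ := param x hx
    obtain ⟨g', u', v', hg', hv', hvu', h1', h2', h3', -⟩ := param y hy
    rw [φeq hg hvu h1 h2 h3, φeq hg' hvu' h1' h2' h3'] at hxy
    simp only [Prod.mk.injEq] at hxy
    obtain ⟨⟨rfl, e1⟩, e2⟩ := hxy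
    have : u = u' := by omega
    have : v = v' := by omega
    subst u' v'
    exact Prod.ext (h2.trans h2'.symm) (h3.trans h3'.symm)
  have hφmem : ∀ x ∈ P, φ x ∈ (Icc 1 m ×ˢ Icc 1 m) ×ˢ Icc 1 m := by
    intro x hx
    obtain ⟨g, u, v, hg, hv, hvu, h1, h2, h3, hle⟩ := param x hx
    rw [φeq hg hvu h1 h2 h3]
    rw [h2] at hle
    have a1 : g ≤ u * g := Nat.le_mul_of_pos_left _ (by omega)
    have a2 : u ≤ u * g := Nat.le_mul_of_pos_right _ hg
    simp only [mem_product, mem_Icc]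
    omega
  have hF0 : ∀ y, 0 ≤ F y := by
    intro y
    have : 0 ≤ distInt (θ * ((y.1.1 * y.1.2) * y.2 : ℕ)) := abs_nonneg _
    simp only [F]
    positivity
  calc _ ≤ ∑ x ∈ P, F (φ x) := by
        refine sum_le_sum fun x hx => ?_
        obtain ⟨g, u, v, hg, hv, hvu, h1, h2, h3, hle⟩ := param x hx
        rw [φeq hg hvu h1 h2 h3, h1, h2, h3]
        have eK : (u * g - v * g) * (u * g + v * g) / g = g * (u - v) * (u + v) := by
          rw [← Nat.sub_mul, ← Nat.add_mul]
          rw [show (u - v) * g * ((u + v) * g) = (g * (u - v) * (u + v)) * g by ring]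
          exact Nat.mul_div_cancel _ hg
        rw [eK]
        simp only [F]
        have hgR : (0 : ℝ) < g := by exact_mod_cast hg
        have hd0 : 0 ≤ distInt (θ * ((g * (u - v)) * (u + v) : ℕ)) := abs_nonneg _
        have hδ : (0 : ℝ) < ((u - v : ℕ) : ℝ) := by exact_mod_cast Nat.sub_pos_of_lt hvu
        have hσ : (0 : ℝ) < ((u + v : ℕ) : ℝ) := by exact_mod_cast (by omega : 0 < u + v)
        have hδσ : ((u - v : ℕ) : ℝ) ≤ ((u + v : ℕ) : ℝ) := by
          exact_mod_cast (by omega : u - v ≤ u + v)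
        have hu2 : ((u + v : ℕ) : ℝ) / 2 ≤ u := by
          have : ((u + v : ℕ) : ℝ) ≤ 2 * u := by exact_mod_cast (by omega : u + v ≤ 2 * u)
          linarith
        have b1 : ((u * g : ℕ) : ℝ) ^ (-3 + s) ≤
            8 * (((u + v : ℕ) : ℝ) ^ (-3 + s) * (g : ℝ) ^ (-3 + s)) := by
          rw [Nat.cast_mul]
          calc ((u : ℝ) * g) ^ (-3 + s) ≤ (((u + v : ℕ) : ℝ) / 2 * g) ^ (-3 + s) := by
                refine Real.rpow_le_rpow_of_nonpos (by positivity) ?_ (by linarith)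
                gcongr
            _ = (2 : ℝ) ^ (3 - s) * (((u + v : ℕ) : ℝ) ^ (-3 + s) * (g : ℝ) ^ (-3 + s)) := by
                rw [Real.mul_rpow (by positivity) hgR.le, Real.div_rpow hσ.le (by norm_num),
                  show (3 - s) = -(-3 + s) by ring, Real.rpow_neg (by norm_num)]
                ring
            _ ≤ (2 : ℝ) ^ (3 : ℝ) * (((u + v : ℕ) : ℝ) ^ (-3 + s) * (g : ℝ) ^ (-3 + s)) := by
                gcongr
                · norm_num
                · linarith
            _ = _ := by norm_num
        have b2 : ((u + v : ℕ) : ℝ) ^ (-3 + s) ≤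
            ((u - v : ℕ) : ℝ) ^ (-2 + s) * ((u + v : ℕ) : ℝ)⁻¹ := by
          rw [show -3 + s = (-2 + s) + -1 by ring, Real.rpow_add hσ, Real.rpow_neg_one]
          gcongr ?_ * _
          exact Real.rpow_le_rpow_of_nonpos hδ hδσ (by linarith)
        have b3 : (g : ℝ) ^ (-2 : ℝ) = (g : ℝ) ^ (1 - s) * (g : ℝ) ^ (-3 + s) := by
          rw [← Real.rpow_add hgR]; congr 1; ring
        rw [b3]
        calc _ ≤ (g : ℝ) ^ (1 - s) * (8 * ((((u - v : ℕ) : ℝ) ^ (-2 + s) * ((u + v : ℕ) : ℝ)⁻¹)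
              * (g : ℝ) ^ (-3 + s))) *
              distInt (θ * ((g * (u - v)) * (u + v) : ℕ)) ^ (-s) := by
              gcongr
              exact b1.trans (by gcongr)
          _ = _ := by rw [div_eq_mul_inv]; ring
    _ = ∑ y ∈ P.image φ, F y := (sum_image hφinj).symm
    _ ≤ ∑ y ∈ (Icc 1 m ×ˢ Icc 1 m) ×ˢ Icc 1 m, F y := by
        refine sum_le_sum_of_subset_of_nonneg ?_ fun y _ _ => hF0 y
        exact image_subset_iff.mpr hφmem
    _ = ∑ x ∈ Icc 1 m ×ˢ Icc 1 m, 8 * (x.1 : ℝ) ^ (-2 : ℝ) * (x.2 : ℝ) ^ (-2 + s) *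
          ∑ σ ∈ Icc 1 m, distInt (θ * ((x.1 * x.2) * σ : ℕ)) ^ (-s) / σ := by
        rw [sum_product]
        simp only [F, mul_sum]
    _ ≤ ∑ x ∈ Icc 1 m ×ˢ Icc 1 m, (16 * (c / 2) ^ (-s) * (1 + Real.log N) ^ 2 * N ^ κ) *
          ((x.1 : ℝ)⁻¹ * (x.2 : ℝ)⁻¹) := by
        refine sum_le_sum fun x hx => ?_
        obtain ⟨h1, h2⟩ := mem_product.mp hx
        obtain ⟨h1a, h1b⟩ := mem_Icc.mp h1
        obtain ⟨h2a, h2b⟩ := mem_Icc.mp h2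
        have hg1 : (1 : ℝ) ≤ x.1 := by exact_mod_cast h1a
        have hd1 : (1 : ℝ) ≤ x.2 := by exact_mod_cast h2a
        have hg : (0 : ℝ) < x.1 := by linarith
        have hd : (0 : ℝ) < x.2 := by linarith
        have hdN : (x.2 : ℝ) ≤ N := le_trans (by exact_mod_cast h2b) hmN
        have e1 : (x.1 : ℝ) ^ (-2 : ℝ) * (x.1 : ℝ) ^ (a * s) ≤ (x.1 : ℝ)⁻¹ := by
          rw [← Real.rpow_add hg, ← Real.rpow_neg_one]
          exact Real.rpow_le_rpow_of_exponent_le hg1 (by linarith)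
        have e2 : (x.2 : ℝ) ^ (-2 + s) * (x.2 : ℝ) ^ (a * s) ≤ (x.2 : ℝ)⁻¹ * N ^ κ := by
          rw [← Real.rpow_add hd, show -2 + s + a * s = -1 + κ by linarith, Real.rpow_add hd,
            Real.rpow_neg_one]
          gcongr
        have key := sum_distInt_rpow_neg_div_le ha hc H hs has (Nat.mul_pos h1a h2a) hN1 hmN
        calc _ ≤ 8 * (x.1 : ℝ) ^ (-2 : ℝ) * (x.2 : ℝ) ^ (-2 + s) *
              ((c / 2) ^ (-s) * 2 * ((x.1 * x.2 : ℕ) : ℝ) ^ (a * s) * (1 + Real.log N) ^ 2) := by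
              gcongr
          _ = (16 * (c / 2) ^ (-s) * (1 + Real.log N) ^ 2) *
              (((x.1 : ℝ) ^ (-2 : ℝ) * (x.1 : ℝ) ^ (a * s)) *
                ((x.2 : ℝ) ^ (-2 + s) * (x.2 : ℝ) ^ (a * s))) := by
              rw [Nat.cast_mul, Real.mul_rpow hg.le hd.le]; ring
          _ ≤ (16 * (c / 2) ^ (-s) * (1 + Real.log N) ^ 2) *
              ((x.1 : ℝ)⁻¹ * ((x.2 : ℝ)⁻¹ * N ^ κ)) := by gcongr
          _ = _ := by ring
    _ = (16 * (c / 2) ^ (-s) * (1 + Real.log N) ^ 2 * N ^ κ) *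
          ((∑ j ∈ Icc 1 m, (j : ℝ)⁻¹) * (∑ j ∈ Icc 1 m, (j : ℝ)⁻¹)) := by
        rw [← mul_sum, sum_mul_sum, sum_product]
    _ ≤ (16 * (c / 2) ^ (-s) * (1 + Real.log N) ^ 2 * N ^ κ) *
          ((1 + Real.log N) * (1 + Real.log N)) := by
        have := sum_Icc_inv_le (n := m) hN1 hmN
        gcongr
    _ = _ := by ring

end Diophantine

/-- The frequency `h (2 r - θ h)` attached to the pair `(h, r)`. -/
noncomputable def lam (θ : ℝ) (p : ℕ × ℕ) : ℝ := p.1 * (2 * p.2 - θ * p.1)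

/-- The pairs `(h, r)` with `h ≥ 1` and `r > θ h`. -/
def Admissible (θ : ℝ) (p : ℕ × ℕ) : Prop := 1 ≤ p.1 ∧ θ * p.1 < p.2

section lam

variable {θ : ℝ} {p q : ℕ × ℕ}

lemma Admissible.fst_ge (hp : Admissible θ p) : (1 : ℝ) ≤ p.1 := by exact_mod_cast hp.1

lemma Admissible.snd_pos (hθ : 0 < θ) (hp : Admissible θ p) : (0 : ℝ) < p.2 :=
  lt_trans (mul_pos hθ (by linarith [hp.fst_ge])) hp.2

lemma Admissible.snd_one_le (hθ : 0 < θ) (hp : Admissible θ p) : 1 ≤ p.2 := by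
  exact_mod_cast hp.snd_pos hθ

lemma Admissible.mul_le_lam (hp : Admissible θ p) : (p.1 : ℝ) * p.2 ≤ lam θ p := by
  have := hp.fst_ge
  have := hp.2
  unfold lam
  gcongr
  linarith

lemma Admissible.lam_le (hθ : 0 < θ) (hp : Admissible θ p) : lam θ p ≤ 2 * (p.1 * p.2) := by
  have h1 := hp.fst_ge
  unfold lam
  have : 0 ≤ (p.1 : ℝ) * (θ * p.1) := by positivity
  linarith

lemma Admissible.sq_le_lam (hp : Admissible θ p) : θ * (p.1 : ℝ) ^ 2 ≤ lam θ p := by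
  have h1 := hp.fst_ge
  refine le_trans ?_ hp.mul_le_lam
  have := hp.2
  nlinarith

lemma Admissible.lam_pos (hθ : 0 < θ) (hp : Admissible θ p) : 0 < lam θ p :=
  lt_of_lt_of_le (mul_pos (by linarith [hp.fst_ge]) (hp.snd_pos hθ)) hp.mul_le_lam

lemma lam_sub_lam (θ : ℝ) (p q : ℕ × ℕ) : lam θ p - lam θ q =
    2 * ((p.1 * p.2 - q.1 * q.2 : ℤ) : ℝ) - θ * ((p.1 : ℝ) ^ 2 - (q.1 : ℝ) ^ 2) := by
  unfold lam; push_cast; ring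

/-- Two admissible pairs whose frequencies differ by a factor of at most `2`. -/
def NearPair (θ : ℝ) (x : (ℕ × ℕ) × (ℕ × ℕ)) : Prop :=
  Admissible θ x.1 ∧ Admissible θ x.2 ∧ lam θ x.1 ≤ 2 * lam θ x.2 ∧ lam θ x.2 ≤ 2 * lam θ x.1

lemma NearPair.swap {x : (ℕ × ℕ) × (ℕ × ℕ)} (h : NearPair θ x) : NearPair θ x.swap :=
  ⟨h.2.1, h.1, h.2.2.2, h.2.2.1⟩

lemma NearPair.sq_le_mul {x : (ℕ × ℕ) × (ℕ × ℕ)} (hθ : 0 < θ) (h : NearPair θ x) :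
    θ / 4 * ((max x.1.1 x.2.1 : ℕ) : ℝ) ^ 2 ≤ x.1.1 * x.1.2 := by
  obtain ⟨hp, hq, h1, h2⟩ := h
  have a1 := hp.sq_le_lam
  have a2 := hq.sq_le_lam
  have a3 := hp.lam_le hθ
  have hpos : 0 ≤ θ * (x.1.1 : ℝ) ^ 2 := by positivity
  rcases le_total x.1.1 x.2.1 with h | h
  · rw [max_eq_right h]; linarith
  · rw [max_eq_left h]
    have := hp.2
    have := hp.fst_ge
    nlinarith

lemma NearPair.max_le_snd {x : (ℕ × ℕ) × (ℕ × ℕ)} (hθ : 0 < θ) (h : NearPair θ x) :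
    θ / 4 * ((max x.1.1 x.2.1 : ℕ) : ℝ) ≤ x.1.2 := by
  have h1 := h.sq_le_mul hθ
  have h2 : (x.1.1 : ℝ) ≤ ((max x.1.1 x.2.1 : ℕ) : ℝ) := by exact_mod_cast le_max_left _ _
  have h3 := h.1.fst_ge
  set M := ((max x.1.1 x.2.1 : ℕ) : ℝ)
  have hr := h.1.snd_pos hθ
  have : θ / 4 * M ^ 2 ≤ M * x.1.2 := h1.trans (by gcongr)
  have hM : 0 < M := by linarith
  refine le_of_mul_le_mul_left ?_ hM
  linarith

end lam

section FixedFirst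

variable {θ c N : ℝ} {h h' : ℕ} {Q : Finset ((ℕ × ℕ) × (ℕ × ℕ))}

lemma gcd_dvd_value {x : (ℕ × ℕ) × (ℕ × ℕ)} :
    ((Nat.gcd x.1.1 x.2.1 : ℕ) : ℤ) ∣ (x.1.1 * x.1.2 - x.2.1 * x.2.2 : ℤ) := by
  have h1 : ((Nat.gcd x.1.1 x.2.1 : ℕ) : ℤ) ∣ x.1.1 := by exact_mod_cast Nat.gcd_dvd_left _ _
  have h2 : ((Nat.gcd x.1.1 x.2.1 : ℕ) : ℤ) ∣ x.2.1 := by exact_mod_cast Nat.gcd_dvd_right _ _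
  exact dvd_sub (h1.mul_right _) (h2.mul_right _)

lemma sum_inv_mul_le_of_value_eq (hθ : 0 < θ) (hh : 0 < h) (hh' : 0 < h') (hc : 0 < c)
    (hc1 : c ≤ 1) (hcθ : c ≤ θ / 4) (hN1 : 1 ≤ N) (n : ℤ)
    (hnear : ∀ x ∈ Q, NearPair θ x) (hfst : ∀ x ∈ Q, x.1.1 = h ∧ x.2.1 = h')
    (hN : ∀ x ∈ Q, (x.1.2 : ℝ) ≤ c * N ∧ (x.2.2 : ℝ) ≤ c * N)
    (hn : ∀ x ∈ Q, (x.1.1 * x.1.2 - x.2.1 * x.2.2 : ℤ) = n) :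
    ∑ x ∈ Q, ((x.1.2 : ℝ) * x.2.2)⁻¹ ≤
      (Nat.gcd h h') / (c ^ 2 * ((max h h' : ℕ) : ℝ) ^ 2) * (1 + Real.log N) := by
  refine sum_inv_mul_le_of_linear Q (fun x => x.1.2) (fun x => x.2.2) (n := n) hh hh' hc hc1 hN1
    ?_ ?_ ?_ ?_ (fun x hx => (hN x hx).1) (fun x hx => (hN x hx).2)
  · intro x hx y hy h1 h2
    obtain ⟨a1, a2⟩ := hfst x hx
    obtain ⟨b1, b2⟩ := hfst y hy
    exact Prod.ext (Prod.ext (a1.trans b1.symm) h1) (Prod.ext (a2.trans b2.symm) h2)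
  · intro x hx
    have := hn x hx
    rwa [(hfst x hx).1, (hfst x hx).2] at this
  · intro x hx
    have h1 := (hnear x hx).max_le_snd hθ
    rw [(hfst x hx).1, (hfst x hx).2] at h1
    exact le_trans (by gcongr) h1
  · intro x hx
    have h1 := (hnear x hx).swap.max_le_snd hθ
    simp only [Prod.fst_swap, Prod.snd_swap] at h1
    rw [(hfst x hx).1, (hfst x hx).2, max_comm] at h1
    exact le_trans (by gcongr) h1

lemma sum_inv_abs_sub_le {g : ℕ} (hg : 0 < g) (y : ℝ) (V : Finset ℤ) (hN1 : 1 ≤ N)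
    (hdvd : ∀ v ∈ V, (g : ℤ) ∣ v) (hlow : ∀ v ∈ V, (g : ℝ) ≤ |2 * (v : ℝ) - y|)
    (hup : ∀ v ∈ V, |2 * (v : ℝ) - y| ≤ N) :
    ∑ v ∈ V, |2 * (v : ℝ) - y|⁻¹ ≤ 2 * (1 + Real.log N) / g := by
  have hgR : (1 : ℝ) ≤ g := by exact_mod_cast hg
  have hg0 : (0 : ℝ) < g := by linarith
  have half : ∀ W ⊆ V, (∀ v ∈ W, ∀ w ∈ W,
      |(|2 * (v : ℝ) - y| - |2 * (w : ℝ) - y|)| = 2 * |(v : ℝ) - w|) →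
      ∑ v ∈ W, |2 * (v : ℝ) - y|⁻¹ ≤ (1 + Real.log N) / g := by
    intro W hW hdiff
    have key := sum_inv_le_of_separated W (fun v : ℤ => |2 * (v : ℝ) - y| / g) hN1 ?_ ?_ ?_
    · rw [le_div_iff₀ hg0, sum_mul]
      refine le_trans (le_of_eq ?_) key
      refine sum_congr rfl fun v _ => ?_
      rw [inv_div, div_eq_mul_inv, mul_comm]
    · intro v hv
      rw [le_div_iff₀ hg0, one_mul]
      exact hlow v (hW hv)
    · intro v hv
      exact (div_le_self (abs_nonneg _) hgR).trans (hup v (hW hv))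
    · intro v hv w hw hne
      rw [← sub_div, abs_div, hdiff v hv w hw, abs_of_pos hg0, le_div_iff₀ hg0]
      have hd : (g : ℤ) ∣ |v - w| := (dvd_abs _ _).mpr (dvd_sub (hdvd v (hW hv)) (hdvd w (hW hw)))
      have hle : (g : ℤ) ≤ |v - w| := Int.le_of_dvd (abs_pos.mpr (sub_ne_zero.mpr hne)) hd
      have hle' : (g : ℝ) ≤ |(v : ℝ) - w| := by exact_mod_cast hle
      linarith
  rw [← sum_filter_add_sum_filter_not V (fun v : ℤ => 0 ≤ 2 * (v : ℝ) - y)]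
  have h1 := half (V.filter (fun v : ℤ => 0 ≤ 2 * (v : ℝ) - y)) (filter_subset _ _) (by
    intro v hv w hw
    rw [abs_of_nonneg (mem_filter.mp hv).2, abs_of_nonneg (mem_filter.mp hw).2,
      show (2 * (v : ℝ) - y - (2 * (w : ℝ) - y)) = 2 * ((v : ℝ) - w) by ring, abs_mul, abs_two])
  have h2 := half (V.filter (fun v : ℤ => ¬ 0 ≤ 2 * (v : ℝ) - y)) (filter_subset _ _) (by
    intro v hv w hw
    rw [abs_of_neg (not_le.mp (mem_filter.mp hv).2), abs_of_neg (not_le.mp (mem_filter.mp hw).2),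
      show (-(2 * (v : ℝ) - y) - -(2 * (w : ℝ) - y)) = 2 * ((w : ℝ) - v) by ring, abs_mul, abs_two,
      abs_sub_comm])
  calc _ ≤ _ := add_le_add h1 h2
    _ = _ := by ring

lemma sum_near_spaced_le_of_fst (hθ : 0 < θ) (hh : 0 < h) (hh' : 0 < h') (hc : 0 < c)
    (hc1 : c ≤ 1) (hcθ : c ≤ θ / 4) (hN1 : 1 ≤ N)
    (hnear : ∀ x ∈ Q, NearPair θ x) (hfst : ∀ x ∈ Q, x.1.1 = h ∧ x.2.1 = h')
    (hN : ∀ x ∈ Q, (x.1.2 : ℝ) ≤ c * N ∧ (x.2.2 : ℝ) ≤ c * N)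
    (hlow : ∀ x ∈ Q, ((Nat.gcd h h' : ℕ) : ℝ) ≤ |lam θ x.1 - lam θ x.2|)
    (hup : ∀ x ∈ Q, |lam θ x.1 - lam θ x.2| ≤ N) :
    ∑ x ∈ Q, ((x.1.2 : ℝ) * x.2.2)⁻¹ * |lam θ x.1 - lam θ x.2|⁻¹ ≤
      2 / c ^ 2 * (1 + Real.log N) ^ 2 * ((h : ℝ)⁻¹ * (h' : ℝ)⁻¹) := by
  have hL : 0 ≤ Real.log N := Real.log_nonneg hN1
  set g := Nat.gcd h h' with hgdef
  have hg : 0 < g := Nat.gcd_pos_of_pos_left _ hh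
  set y := θ * ((h : ℝ) ^ 2 - (h' : ℝ) ^ 2) with hy
  let ν : (ℕ × ℕ) × (ℕ × ℕ) → ℤ := fun x => x.1.1 * x.1.2 - x.2.1 * x.2.2
  have hlam : ∀ x ∈ Q, lam θ x.1 - lam θ x.2 = 2 * (ν x : ℝ) - y := by
    intro x hx
    rw [lam_sub_lam, (hfst x hx).1, (hfst x hx).2, hy]
    simp only [ν]
    rw [(hfst x hx).1, (hfst x hx).2]
  set V := Q.image ν
  have hmap : ∀ x ∈ Q, ν x ∈ V := fun x hx => mem_image_of_mem _ hx
  rw [← sum_fiberwise_of_maps_to hmap]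
  have hhR : (0 : ℝ) < h := by exact_mod_cast hh
  have hhR' : (0 : ℝ) < h' := by exact_mod_cast hh'
  have hgR : (0 : ℝ) < g := by exact_mod_cast hg
  calc _ ≤ ∑ v ∈ V, |2 * (v : ℝ) - y|⁻¹ *
        (g / (c ^ 2 * ((max h h' : ℕ) : ℝ) ^ 2) * (1 + Real.log N)) := by
        refine sum_le_sum fun v hv => ?_
        have e : ∑ x ∈ Q with ν x = v, ((x.1.2 : ℝ) * x.2.2)⁻¹ * |lam θ x.1 - lam θ x.2|⁻¹ =
            |2 * (v : ℝ) - y|⁻¹ * ∑ x ∈ Q with ν x = v, ((x.1.2 : ℝ) * x.2.2)⁻¹ := by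
          rw [mul_sum]
          refine sum_congr rfl fun x hx => ?_
          obtain ⟨hx1, hx2⟩ := mem_filter.mp hx
          rw [hlam x hx1, hx2, mul_comm]
        rw [e]
        refine mul_le_mul_of_nonneg_left ?_ (by positivity)
        exact sum_inv_mul_le_of_value_eq hθ hh hh' hc hc1 hcθ hN1 v
          (fun x hx => hnear x (mem_filter.mp hx).1) (fun x hx => hfst x (mem_filter.mp hx).1)
          (fun x hx => hN x (mem_filter.mp hx).1) (fun x hx => (mem_filter.mp hx).2)
    _ = (∑ v ∈ V, |2 * (v : ℝ) - y|⁻¹) *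
        (g / (c ^ 2 * ((max h h' : ℕ) : ℝ) ^ 2) * (1 + Real.log N)) := by rw [sum_mul]
    _ ≤ (2 * (1 + Real.log N) / g) *
        (g / (c ^ 2 * (h * h')) * (1 + Real.log N)) := by
        have hmax : (h : ℝ) * h' ≤ ((max h h' : ℕ) : ℝ) ^ 2 := by
          have h1 : (h : ℝ) ≤ ((max h h' : ℕ) : ℝ) := by exact_mod_cast le_max_left _ _
          have h2 : (h' : ℝ) ≤ ((max h h' : ℕ) : ℝ) := by exact_mod_cast le_max_right _ _
          nlinarith
        gcongr
        refine sum_inv_abs_sub_le hg y V hN1 ?_ ?_ ?_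
        · intro v hv
          obtain ⟨x, hx, rfl⟩ := mem_image.mp hv
          have := gcd_dvd_value (x := x)
          rwa [(hfst x hx).1, (hfst x hx).2, ← hgdef, ← (hfst x hx).1, ← (hfst x hx).2] at this
        · intro v hv
          obtain ⟨x, hx, rfl⟩ := mem_image.mp hv
          rw [← hlam x hx]; exact hlow x hx
        · intro v hv
          obtain ⟨x, hx, rfl⟩ := mem_image.mp hv
          rw [← hlam x hx]; exact hup x hx
    _ = _ := by field_simp

end FixedFirst

section Total

lemma distInt_nonneg (x : ℝ) : 0 ≤ distInt x := abs_nonneg _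

variable {θ a b c N s κ : ℝ} {n : ℕ} {Q : Finset ((ℕ × ℕ) × (ℕ × ℕ))}

lemma sum_near_spaced_le (hθ : 0 < θ) (hc : 0 < c) (hc1 : c ≤ 1) (hcθ : c ≤ θ / 4) (hN1 : 1 ≤ N)
    (hn : (n : ℝ) ≤ N) (hnear : ∀ x ∈ Q, NearPair θ x)
    (hfst : ∀ x ∈ Q, x.1.1 ≤ n ∧ x.2.1 ≤ n)
    (hN : ∀ x ∈ Q, (x.1.2 : ℝ) ≤ c * N ∧ (x.2.2 : ℝ) ≤ c * N)
    (hlow : ∀ x ∈ Q, ((Nat.gcd x.1.1 x.2.1 : ℕ) : ℝ) ≤ |lam θ x.1 - lam θ x.2|)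
    (hup : ∀ x ∈ Q, |lam θ x.1 - lam θ x.2| ≤ N) :
    ∑ x ∈ Q, ((x.1.2 : ℝ) * x.2.2)⁻¹ * |lam θ x.1 - lam θ x.2|⁻¹ ≤
      2 / c ^ 2 * (1 + Real.log N) ^ 4 := by
  have hL : 0 ≤ Real.log N := Real.log_nonneg hN1
  have hmap : ∀ x ∈ Q, (fun x : (ℕ × ℕ) × (ℕ × ℕ) => (x.1.1, x.2.1)) x ∈ Icc 1 n ×ˢ Icc 1 n := by
    intro x hx
    have h1 := (hnear x hx).1.1
    have h2 := (hnear x hx).2.1.1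
    have h3 := hfst x hx
    simp only [mem_product, mem_Icc]
    omega
  rw [← sum_fiberwise_of_maps_to hmap]
  calc _ ≤ ∑ y ∈ Icc 1 n ×ˢ Icc 1 n,
        2 / c ^ 2 * (1 + Real.log N) ^ 2 * ((y.1 : ℝ)⁻¹ * (y.2 : ℝ)⁻¹) := by
        refine sum_le_sum fun y hy => ?_
        obtain ⟨h1, h2⟩ := mem_product.mp hy
        have hk : ∀ x ∈ Q.filter (fun x : (ℕ × ℕ) × (ℕ × ℕ) => (x.1.1, x.2.1) = y),
            x ∈ Q ∧ x.1.1 = y.1 ∧ x.2.1 = y.2 := by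
          intro x hx
          obtain ⟨hx1, hx2⟩ := mem_filter.mp hx
          have hx3 := Prod.ext_iff.mp hx2
          exact ⟨hx1, hx3.1, hx3.2⟩
        refine sum_near_spaced_le_of_fst hθ (mem_Icc.mp h1).1 (mem_Icc.mp h2).1 hc hc1 hcθ hN1
          (fun x hx => hnear x (hk x hx).1) (fun x hx => (hk x hx).2)
          (fun x hx => hN x (hk x hx).1) (fun x hx => ?_) (fun x hx => hup x (hk x hx).1)
        have := hlow x (hk x hx).1
        rwa [(hk x hx).2.1, (hk x hx).2.2] at this
    _ = 2 / c ^ 2 * (1 + Real.log N) ^ 2 *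
          ((∑ j ∈ Icc 1 n, (j : ℝ)⁻¹) * (∑ j ∈ Icc 1 n, (j : ℝ)⁻¹)) := by
        rw [← mul_sum, sum_mul_sum, sum_product]
    _ ≤ 2 / c ^ 2 * (1 + Real.log N) ^ 2 * ((1 + Real.log N) * (1 + Real.log N)) := by
        have := sum_Icc_inv_le (n := n) hN1 hn
        gcongr
    _ = _ := by ring

lemma sum_near_close_le_of_fst {h h' : ℕ} (hθ : 0 < θ) (hb : 0 < b)
    (H : ∀ p : ℤ, ∀ q : ℕ, 0 < q → b * (q : ℝ) ^ (-a) ≤ |θ * q - p|) (hs : 0 < s)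
    (hh' : 0 < h') (hlt : h' < h) (hc : 0 < c) (hc1 : c ≤ 1) (hcθ : c ≤ θ / 4) (hN1 : 1 ≤ N)
    (hnear : ∀ x ∈ Q, NearPair θ x) (hfst : ∀ x ∈ Q, x.1.1 = h ∧ x.2.1 = h')
    (hN : ∀ x ∈ Q, (x.1.2 : ℝ) ≤ c * N ∧ (x.2.2 : ℝ) ≤ c * N)
    (hclose : ∀ x ∈ Q, |lam θ x.1 - lam θ x.2| < ((Nat.gcd h h' : ℕ) : ℝ)) :
    ∑ x ∈ Q, ((x.1.2 : ℝ) * x.2.2)⁻¹ * |lam θ x.1 - lam θ x.2| ^ (-s) ≤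
      (Nat.gcd h h') / (c ^ 2 * (h : ℝ) ^ 2) * (1 + Real.log N) *
        ((Nat.gcd h h' : ℕ) * distInt (θ * ((h - h') * (h + h') / Nat.gcd h h' : ℕ))) ^ (-s) := by
  have hh : 0 < h := by omega
  set g := Nat.gcd h h' with hgdef
  have hg : 0 < g := Nat.gcd_pos_of_pos_left _ hh
  have hgR : (0 : ℝ) < g := by exact_mod_cast hg
  set K := (h - h') * (h + h') / g with hK
  have hgK : g * K = (h - h') * (h + h') :=
    Nat.mul_div_cancel' ((Nat.dvd_add (Nat.gcd_dvd_left _ _) (Nat.gcd_dvd_right _ _)).mul_left _)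
  have hKpos : 0 < K := by
    refine Nat.pos_of_ne_zero fun h0 => ?_
    rw [h0, mul_zero] at hgK
    have : 0 < (h - h') * (h + h') := Nat.mul_pos (by omega) (by omega)
    omega
  have hgK' : (g : ℝ) * K = (h : ℝ) ^ 2 - (h' : ℝ) ^ 2 := by
    have : ((g * K : ℕ) : ℝ) = (((h - h') * (h + h') : ℕ) : ℝ) := by rw [hgK]
    push_cast [Nat.cast_sub hlt.le] at this
    rw [this]; ring
  have hpos := distInt_pos hb H hKpos
  have hval : ∀ x ∈ Q, ∃ m : ℤ, (x.1.1 * x.1.2 - x.2.1 * x.2.2 : ℤ) = g * m ∧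
      lam θ x.1 - lam θ x.2 = g * (2 * (m : ℝ) - θ * K) := by
    intro x hx
    obtain ⟨m, hm⟩ := gcd_dvd_value (x := x)
    rw [lam_sub_lam, hm, (hfst x hx).1, (hfst x hx).2]
    refine ⟨m, rfl, ?_⟩
    rw [← hgdef, ← hgK']
    push_cast
    ring
  have hlow : ∀ x ∈ Q, g * distInt (θ * K) ≤ |lam θ x.1 - lam θ x.2| := by
    intro x hx
    obtain ⟨m, -, hm⟩ := hval x hx
    rw [hm, abs_mul, abs_of_pos hgR, abs_sub_comm]
    have := round_le (θ * K) (2 * m)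
    push_cast at this
    unfold distInt
    gcongr
  obtain ⟨v, hv⟩ : ∃ v : ℤ, ∀ x ∈ Q, (x.1.1 * x.1.2 - x.2.1 * x.2.2 : ℤ) = v := by
    rcases Q.eq_empty_or_nonempty with h0 | ⟨x, hx⟩
    · exact ⟨0, by simp [h0]⟩
    refine ⟨x.1.1 * x.1.2 - x.2.1 * x.2.2, fun y hy => ?_⟩
    obtain ⟨m, hm, hm'⟩ := hval x hx
    obtain ⟨m', hmy, hmy'⟩ := hval y hy
    have c1 := hclose x hx
    have c2 := hclose y hy
    rw [hm', abs_mul, abs_of_pos hgR, mul_lt_iff_lt_one_right hgR, abs_lt] at c1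
    rw [hmy', abs_mul, abs_of_pos hgR, mul_lt_iff_lt_one_right hgR, abs_lt] at c2
    have d1 : (m : ℝ) < m' + 1 := by linarith
    have d2 : (m' : ℝ) < m + 1 := by linarith
    have d1' : m < m' + 1 := by exact_mod_cast d1
    have d2' : m' < m + 1 := by exact_mod_cast d2
    rw [hm, hmy, show m = m' by omega]
  have hmax : max h h' = h := max_eq_left hlt.le
  have key := sum_inv_mul_le_of_value_eq hθ hh hh' hc hc1 hcθ hN1 v hnear hfst hN hv
  rw [hmax] at key
  calc _ ≤ ∑ x ∈ Q, ((x.1.2 : ℝ) * x.2.2)⁻¹ * (g * distInt (θ * K)) ^ (-s) := by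
        refine sum_le_sum fun x hx => ?_
        gcongr ?_ * ?_
        exact Real.rpow_le_rpow_of_nonpos (mul_pos hgR hpos) (hlow x hx) (by linarith)
    _ = (∑ x ∈ Q, ((x.1.2 : ℝ) * x.2.2)⁻¹) * (g * distInt (θ * K)) ^ (-s) := by rw [sum_mul]
    _ ≤ _ := by gcongr

lemma sum_near_close_le_of_lt (hθ : 0 < θ) (ha : 0 < a) (hb : 0 < b)
    (H : ∀ p : ℤ, ∀ q : ℕ, 0 < q → b * (q : ℝ) ^ (-a) ≤ |θ * q - p|)
    (hs : 0 < s) (hs1 : s ≤ 1) (has : a * s ≤ 1) (hκ : 0 ≤ κ) (hsκ : s + a * s = 1 + κ)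
    (hc : 0 < c) (hc1 : c ≤ 1) (hcθ : c ≤ θ / 4) (hN1 : 1 ≤ N) (hn : 2 * (n : ℝ) ≤ N)
    (hnear : ∀ x ∈ Q, NearPair θ x) (hfst : ∀ x ∈ Q, x.1.1 ≤ n ∧ x.2.1 ≤ n)
    (hN : ∀ x ∈ Q, (x.1.2 : ℝ) ≤ c * N ∧ (x.2.2 : ℝ) ≤ c * N)
    (hclose : ∀ x ∈ Q, |lam θ x.1 - lam θ x.2| < ((Nat.gcd x.1.1 x.2.1 : ℕ) : ℝ))
    (hlt : ∀ x ∈ Q, x.2.1 < x.1.1) :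
    ∑ x ∈ Q, ((max x.1.1 x.2.1 : ℕ) : ℝ) ^ (-(1 - s)) *
      (((x.1.2 : ℝ) * x.2.2)⁻¹ * |lam θ x.1 - lam θ x.2| ^ (-s)) ≤
      16 * (b / 2) ^ (-s) / c ^ 2 * (1 + Real.log N) ^ 5 * N ^ κ := by
  have hL : 0 ≤ Real.log N := Real.log_nonneg hN1
  have hmap : ∀ x ∈ Q, (fun x : (ℕ × ℕ) × (ℕ × ℕ) => (x.1.1, x.2.1)) x ∈
      (Icc 1 n ×ˢ Icc 1 n).filter (fun x : ℕ × ℕ => x.2 < x.1) := by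
    intro x hx
    have h1 := (hnear x hx).1.1
    have h2 := (hnear x hx).2.1.1
    have h3 := hfst x hx
    have h4 := hlt x hx
    simp only [mem_filter, mem_product, mem_Icc]
    omega
  rw [← sum_fiberwise_of_maps_to hmap]
  calc _ ≤ ∑ y ∈ (Icc 1 n ×ˢ Icc 1 n).filter (fun x : ℕ × ℕ => x.2 < x.1),
        (1 + Real.log N) / c ^ 2 * (((Nat.gcd y.1 y.2 : ℕ) : ℝ) ^ (1 - s) * (y.1 : ℝ) ^ (-3 + s) *
        distInt (θ * ((y.1 - y.2) * (y.1 + y.2) / Nat.gcd y.1 y.2 : ℕ)) ^ (-s)) := by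
        refine sum_le_sum fun y hy => ?_
        obtain ⟨hy1, hylt⟩ := mem_filter.mp hy
        obtain ⟨h1, h2⟩ := mem_product.mp hy1
        have hk : ∀ x ∈ Q.filter (fun x : (ℕ × ℕ) × (ℕ × ℕ) => (x.1.1, x.2.1) = y),
            x ∈ Q ∧ x.1.1 = y.1 ∧ x.2.1 = y.2 := by
          intro x hx
          obtain ⟨hx1, hx2⟩ := mem_filter.mp hx
          have hx3 := Prod.ext_iff.mp hx2
          exact ⟨hx1, hx3.1, hx3.2⟩
        have key := sum_near_close_le_of_fst hθ hb H hs (mem_Icc.mp h2).1 hylt hc hc1 hcθ hN1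
          (fun x hx => hnear x (hk x hx).1) (fun x hx => (hk x hx).2)
          (fun x hx => hN x (hk x hx).1) (fun x hx => by
            have := hclose x (hk x hx).1
            rwa [(hk x hx).2.1, (hk x hx).2.2] at this)
        have e : ∑ x ∈ Q with (x.1.1, x.2.1) = y, ((max x.1.1 x.2.1 : ℕ) : ℝ) ^ (-(1 - s)) *
            (((x.1.2 : ℝ) * x.2.2)⁻¹ * |lam θ x.1 - lam θ x.2| ^ (-s)) =
            (y.1 : ℝ) ^ (-(1 - s)) * ∑ x ∈ Q with (x.1.1, x.2.1) = y,
            (((x.1.2 : ℝ) * x.2.2)⁻¹ * |lam θ x.1 - lam θ x.2| ^ (-s)) := by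
          rw [mul_sum]
          refine sum_congr rfl fun x hx => ?_
          rw [(hk x hx).2.1, (hk x hx).2.2, max_eq_left hylt.le]
        rw [e]
        have hy0 : (0 : ℝ) < y.1 := by exact_mod_cast (mem_Icc.mp h1).1
        refine (mul_le_mul_of_nonneg_left key (by positivity)).trans (le_of_eq ?_)
        have hg0 : (0 : ℝ) < (Nat.gcd y.1 y.2 : ℕ) := by
          exact_mod_cast Nat.gcd_pos_of_pos_left _ (mem_Icc.mp h1).1
        rw [Real.mul_rpow hg0.le (distInt_nonneg _), show 1 - s = 1 + -s by ring,
          Real.rpow_add hg0, Real.rpow_one, show -3 + s = -(1 + -s) + -2 by ring,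
          Real.rpow_add hy0, Real.rpow_neg hy0.le 2, Real.rpow_two]
        field_simp
    _ = (1 + Real.log N) / c ^ 2 * _ := by rw [← mul_sum]
    _ ≤ (1 + Real.log N) / c ^ 2 *
        (16 * (b / 2) ^ (-s) * (1 + Real.log N) ^ 4 * N ^ κ) := by
        gcongr
        exact sum_gcd_distInt_le ha hb H hs hs1 has hκ hsκ hN1 hn
    _ = _ := by ring

lemma sum_near_close_le (hθ : 0 < θ) (ha : 0 < a) (hb : 0 < b)
    (H : ∀ p : ℤ, ∀ q : ℕ, 0 < q → b * (q : ℝ) ^ (-a) ≤ |θ * q - p|)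
    (hs : 0 < s) (hs1 : s ≤ 1) (has : a * s ≤ 1) (hκ : 0 ≤ κ) (hsκ : s + a * s = 1 + κ)
    (hc : 0 < c) (hc1 : c ≤ 1) (hcθ : c ≤ θ / 4) (hN1 : 1 ≤ N) (hn : 2 * (n : ℝ) ≤ N)
    (hnear : ∀ x ∈ Q, NearPair θ x) (hfst : ∀ x ∈ Q, x.1.1 ≤ n ∧ x.2.1 ≤ n)
    (hN : ∀ x ∈ Q, (x.1.2 : ℝ) ≤ c * N ∧ (x.2.2 : ℝ) ≤ c * N)
    (hclose : ∀ x ∈ Q, |lam θ x.1 - lam θ x.2| < ((Nat.gcd x.1.1 x.2.1 : ℕ) : ℝ))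
    (hne : ∀ x ∈ Q, x.1 ≠ x.2) :
    ∑ x ∈ Q, ((max x.1.1 x.2.1 : ℕ) : ℝ) ^ (-(1 - s)) *
      (((x.1.2 : ℝ) * x.2.2)⁻¹ * |lam θ x.1 - lam θ x.2| ^ (-s)) ≤
      32 * (b / 2) ^ (-s) / c ^ 2 * (1 + Real.log N) ^ 5 * N ^ κ := by
  have hfne : ∀ x ∈ Q, x.1.1 ≠ x.2.1 := by
    intro x hx heq
    have h1 := hclose x hx
    rw [lam_sub_lam, ← heq, Nat.gcd_self, sub_self, mul_zero, sub_zero, ← mul_sub] at h1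
    have hpos := (hnear x hx).1.1
    have hne2 : (x.1.2 : ℤ) - x.2.2 ≠ 0 := fun h0 => hne x hx (Prod.ext heq (by omega))
    have h2 : (1 : ℝ) ≤ |((x.1.2 - x.2.2 : ℤ) : ℝ)| := by exact_mod_cast Int.one_le_abs hne2
    have h3 : (1 : ℝ) ≤ x.1.1 := by exact_mod_cast hpos
    rw [Int.cast_mul, abs_mul, abs_mul, abs_two, Int.cast_natCast, Nat.abs_cast] at h1
    nlinarith
  rw [← sum_filter_add_sum_filter_not Q (fun x => x.2.1 < x.1.1)]
  have h1 := sum_near_close_le_of_lt (Q := Q.filter (fun x => x.2.1 < x.1.1)) hθ ha hb H hs hs1 has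
    hκ hsκ hc hc1 hcθ hN1 hn (fun x hx => hnear x (mem_filter.mp hx).1)
    (fun x hx => hfst x (mem_filter.mp hx).1) (fun x hx => hN x (mem_filter.mp hx).1)
    (fun x hx => hclose x (mem_filter.mp hx).1) (fun x hx => (mem_filter.mp hx).2)
  obtain ⟨Q', hQ', hsum⟩ : ∃ Q' : Finset ((ℕ × ℕ) × (ℕ × ℕ)),
      (∀ y ∈ Q', y.swap ∈ Q ∧ y.2.1 < y.1.1) ∧ ∀ f : (ℕ × ℕ) × (ℕ × ℕ) → ℝ,
        ∑ y ∈ Q', f y = ∑ x ∈ Q.filter (fun x => ¬ x.2.1 < x.1.1), f x.swap := by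
    refine ⟨(Q.filter (fun x => ¬ x.2.1 < x.1.1)).image Prod.swap, fun y hy => ?_, fun f =>
      sum_image fun x _ y _ hxy => Prod.swap_injective hxy⟩
    obtain ⟨x, hx, rfl⟩ := mem_image.mp hy
    obtain ⟨hx1, hx2⟩ := mem_filter.mp hx
    refine ⟨by rwa [Prod.swap_swap], ?_⟩
    have := hfne x hx1
    simp only [Prod.fst_swap, Prod.snd_swap]
    omega
  have h2 := sum_near_close_le_of_lt (Q := Q') hθ ha hb H hs
    hs1 has hκ hsκ hc hc1 hcθ hN1 hn
    (fun x hx => by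
      have := (hnear _ (hQ' x hx).1).swap
      rwa [Prod.swap_swap] at this)
    (fun x hx => (hfst _ (hQ' x hx).1).symm) (fun x hx => (hN _ (hQ' x hx).1).symm)
    (fun x hx => by
      have := hclose _ (hQ' x hx).1
      rwa [abs_sub_comm, Nat.gcd_comm] at this) (fun x hx => (hQ' x hx).2)
  rw [hsum] at h2
  have e : ∀ x ∈ Q.filter (fun x => ¬ x.2.1 < x.1.1),
      ((max x.swap.1.1 x.swap.2.1 : ℕ) : ℝ) ^ (-(1 - s)) *
      (((x.swap.1.2 : ℝ) * x.swap.2.2)⁻¹ * |lam θ x.swap.1 - lam θ x.swap.2| ^ (-s)) =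
      ((max x.1.1 x.2.1 : ℕ) : ℝ) ^ (-(1 - s)) *
      (((x.1.2 : ℝ) * x.2.2)⁻¹ * |lam θ x.1 - lam θ x.2| ^ (-s)) := by
    intro x _
    rw [Prod.fst_swap, Prod.snd_swap, max_comm, mul_comm (x.2.2 : ℝ), abs_sub_comm]
  rw [sum_congr rfl e] at h2
  refine (add_le_add h1 h2).trans (le_of_eq ?_)
  ring

end Total

section OffDiagonal

/-- The upper bound `λ^{-1/4} / r` for the coefficient attached to the pair `(h, r)`. -/
noncomputable def weight (θ : ℝ) (p : ℕ × ℕ) : ℝ := lam θ p ^ (-(1 / 4) : ℝ) * (p.2 : ℝ)⁻¹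

variable {θ : ℝ}

lemma lam_ne_of_ne (hθ : Irrational θ) {p q : ℕ × ℕ} (hp : 1 ≤ p.1) (hpq : p ≠ q) :
    lam θ p ≠ lam θ q := by
  intro h
  have h1 := lam_sub_lam θ p q
  rw [h, sub_self] at h1
  by_cases hf : p.1 = q.1
  · have hf0 : (p.1 : ℝ) ≠ 0 := by positivity
    unfold lam at h
    rw [← hf] at h
    have h2 := mul_left_cancel₀ hf0 h
    exact hpq (Prod.ext hf (by exact_mod_cast (by linarith : (p.2 : ℝ) = q.2)))
  · have hne : ((p.1 : ℤ) ^ 2 - (q.1 : ℤ) ^ 2) ≠ 0 := by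
      intro h0
      have h3 : (p.1 : ℤ) ^ 2 = (q.1 : ℤ) ^ 2 := by linarith
      have h4 : p.1 ^ 2 = q.1 ^ 2 := by exact_mod_cast h3
      exact hf (Nat.pow_left_injective (n := 2) (by norm_num) h4)
    have := hθ.mul_intCast hne
    refine this.ne_int (2 * (p.1 * p.2 - q.1 * q.2)) ?_
    push_cast at h1 ⊢
    linarith

lemma exists_fourth_root {t : ℝ} (ht : 0 < t) : ∃ x : ℝ, 0 < x ∧ t = x ^ 4 ∧ Real.sqrt t = x ^ 2 ∧
    t ^ (-(1 / 4) : ℝ) = x⁻¹ := by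
  have h4 : t = (t ^ (1 / 4 : ℝ)) ^ 4 := by
    rw [← Real.rpow_natCast, ← Real.rpow_mul ht.le]; norm_num
  refine ⟨t ^ (1 / 4 : ℝ), Real.rpow_pos_of_pos ht _, h4, ?_, Real.rpow_neg ht.le _⟩
  conv_lhs => rw [h4]
  rw [show (t ^ (1 / 4 : ℝ)) ^ 4 = ((t ^ (1 / 4 : ℝ)) ^ 2) ^ 2 by ring]
  exact Real.sqrt_sq (by positivity)

lemma near_root_sum_le {x y : ℝ} (hx : 0 < x) (hy : 0 < y) (h1 : x ^ 4 ≤ 2 * y ^ 4)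
    (h2 : y ^ 4 ≤ 2 * x ^ 4) : x ^ 2 + y ^ 2 ≤ 3 * (x * y) := by
  have a1 : x ^ 2 ≤ 3 / 2 * y ^ 2 := by
    refine le_of_sq_le_sq ?_ (by positivity)
    nlinarith [pow_pos hy 4]
  have a2 : y ^ 2 ≤ 3 / 2 * x ^ 2 := by
    refine le_of_sq_le_sq ?_ (by positivity)
    nlinarith [pow_pos hx 4]
  refine le_of_sq_le_sq ?_ (by positivity)
  nlinarith [mul_le_mul_of_nonneg_left a1 (sq_nonneg x), mul_le_mul_of_nonneg_left a2 (sq_nonneg y),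
    mul_pos (pow_pos hx 2) (pow_pos hy 2)]

lemma far_root_sub_ge {x y : ℝ} (hx : 0 < x) (h : 2 * y ^ 4 < x ^ 4) :
    x * y / 4 ≤ |x ^ 2 - y ^ 2| := by
  have a1 : 4 / 3 * y ^ 2 ≤ x ^ 2 := by
    refine le_of_sq_le_sq ?_ (by positivity)
    nlinarith [sq_nonneg (y ^ 2)]
  have a2 : y ≤ x := le_of_sq_le_sq (by nlinarith [sq_nonneg y]) hx.le
  refine le_trans ?_ (le_abs_self _)
  nlinarith [sq_nonneg y]

variable {p q : ℕ × ℕ} {m Z s c : ℝ}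

lemma inv_fourth_root_sq_le (hθ : 0 < θ) (hp : Admissible θ p) {x : ℝ} (hx : 0 < x)
    (h : lam θ p = x ^ 4) : (x ^ 2)⁻¹ ≤ (Real.sqrt θ)⁻¹ * (p.1 : ℝ)⁻¹ := by
  have h1 := hp.sq_le_lam
  have h2 := hp.fst_ge
  have hs := Real.sqrt_pos.mpr hθ
  rw [← mul_inv]
  refine inv_anti₀ (by positivity) (le_of_sq_le_sq ?_ (by positivity))
  rw [mul_pow, Real.sq_sqrt hθ.le, ← pow_mul]
  exact h1.trans h.le

lemma weight_mul_far_le (hθ : 0 < θ) (hp : Admissible θ p) (hq : Admissible θ q)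
    (hfar : 2 * lam θ q < lam θ p ∨ 2 * lam θ p < lam θ q)
    (hm : m * |Real.sqrt (lam θ p) - Real.sqrt (lam θ q)| ≤ 1) :
    weight θ p * weight θ q * m ≤
      4 / θ * (((p.1 : ℝ)⁻¹ * (p.2 : ℝ)⁻¹) * ((q.1 : ℝ)⁻¹ * (q.2 : ℝ)⁻¹)) := by
  obtain ⟨x, hx, hx4, hx2, hxw⟩ := exists_fourth_root (hp.lam_pos hθ)
  obtain ⟨y, hy, hy4, hy2, hyw⟩ := exists_fourth_root (hq.lam_pos hθ)
  have hpr := hp.snd_pos hθ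
  have hqr := hq.snd_pos hθ
  have hD : x * y / 4 ≤ |x ^ 2 - y ^ 2| := by
    rw [hx4, hy4] at hfar
    rcases hfar with h | h
    · exact far_root_sub_ge hx h
    · rw [mul_comm x, abs_sub_comm]; exact far_root_sub_ge hy h
  rw [hx2, hy2] at hm
  have hm' : m ≤ 4 * (x⁻¹ * y⁻¹) := by
    rcases le_total m 0 with h0 | h0
    · exact h0.trans (by positivity)
    have := (mul_le_mul_of_nonneg_left hD h0).trans hm
    rw [← mul_inv, ← div_eq_mul_inv, le_div_iff₀ (by positivity)]
    linarith
  unfold weight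
  rw [hxw, hyw]
  have e1 := inv_fourth_root_sq_le hθ hp hx hx4
  have e2 := inv_fourth_root_sq_le hθ hq hy hy4
  calc _ ≤ x⁻¹ * (p.2 : ℝ)⁻¹ * (y⁻¹ * (q.2 : ℝ)⁻¹) * (4 * (x⁻¹ * y⁻¹)) := by gcongr
    _ = 4 * ((x ^ 2)⁻¹ * (y ^ 2)⁻¹) * ((p.2 : ℝ)⁻¹ * (q.2 : ℝ)⁻¹) := by field_simp
    _ ≤ 4 * (((Real.sqrt θ)⁻¹ * (p.1 : ℝ)⁻¹) * ((Real.sqrt θ)⁻¹ * (q.1 : ℝ)⁻¹)) *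
        ((p.2 : ℝ)⁻¹ * (q.2 : ℝ)⁻¹) := by gcongr
    _ = 4 / (Real.sqrt θ ^ 2) * (((p.1 : ℝ)⁻¹ * (p.2 : ℝ)⁻¹) * ((q.1 : ℝ)⁻¹ * (q.2 : ℝ)⁻¹)) := by
        ring
    _ = _ := by rw [Real.sq_sqrt hθ.le]

lemma weight_mul_near_le (hθ : 0 < θ) (h : NearPair θ (p, q)) (hne : lam θ p ≠ lam θ q)
    (hm : m * |Real.sqrt (lam θ p) - Real.sqrt (lam θ q)| ≤ 1) :
    weight θ p * weight θ q * m ≤ 3 * (((p.2 : ℝ) * q.2)⁻¹ * |lam θ p - lam θ q|⁻¹) := by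
  obtain ⟨hp, hq, hn1, hn2⟩ := h
  obtain ⟨x, hx, hx4, hx2, hxw⟩ := exists_fourth_root (hp.lam_pos hθ)
  obtain ⟨y, hy, hy4, hy2, hyw⟩ := exists_fourth_root (hq.lam_pos hθ)
  have hpr := hp.snd_pos hθ
  have hqr := hq.snd_pos hθ
  simp only at hn1 hn2
  have hD : |lam θ p - lam θ q| = |x ^ 2 - y ^ 2| * (x ^ 2 + y ^ 2) := by
    rw [hx4, hy4, show x ^ 4 - y ^ 4 = (x ^ 2 - y ^ 2) * (x ^ 2 + y ^ 2) by ring, abs_mul,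
      abs_of_pos (by positivity : 0 < x ^ 2 + y ^ 2)]
  have hΔ : 0 < |lam θ p - lam θ q| := abs_pos.mpr (sub_ne_zero.mpr hne)
  rw [hx4, hy4] at hn1 hn2
  have hsum := near_root_sum_le hx hy hn1 hn2
  rw [hx2, hy2] at hm
  have hm' : m ≤ 3 * (x * y) * |lam θ p - lam θ q|⁻¹ := by
    rw [← div_eq_mul_inv, le_div_iff₀ hΔ, hD, ← mul_assoc]
    calc _ ≤ 1 * (x ^ 2 + y ^ 2) := by gcongr
      _ ≤ _ := by linarith
  unfold weight
  rw [hxw, hyw]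
  calc _ ≤ x⁻¹ * (p.2 : ℝ)⁻¹ * (y⁻¹ * (q.2 : ℝ)⁻¹) * (3 * (x * y) * |lam θ p - lam θ q|⁻¹) := by
        gcongr
    _ = _ := by field_simp

lemma weight_mul_close_le (hθ : 0 < θ) (h : NearPair θ (p, q)) (hne : lam θ p ≠ lam θ q)
    (hs : 0 < s) (hs1 : s ≤ 1) (hc : 0 < c) (hc1 : c ≤ 1) (hcθ : c ≤ θ / 4)
    (hm : m ^ s * |Real.sqrt (lam θ p) - Real.sqrt (lam θ q)| ^ s ≤ 1) :
    weight θ p * weight θ q * m ^ s ≤ 3 / c * (((max p.1 q.1 : ℕ) : ℝ) ^ (-(1 - s)) *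
      (((p.2 : ℝ) * q.2)⁻¹ * |lam θ p - lam θ q| ^ (-s))) := by
  have hM1 := h.sq_le_mul hθ
  have hM2 := h.swap.sq_le_mul hθ
  simp only [Prod.fst_swap, Prod.snd_swap] at hM1 hM2
  rw [max_comm] at hM2
  obtain ⟨hp, hq, hn1, hn2⟩ := h
  have hM : 0 < ((max p.1 q.1 : ℕ) : ℝ) := by
    exact_mod_cast lt_of_lt_of_le hp.1 (le_max_left _ _)
  set M := ((max p.1 q.1 : ℕ) : ℝ)
  have hM1' := hM1.trans hp.mul_le_lam
  have hM2' := hM2.trans hq.mul_le_lam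
  obtain ⟨x, hx, hx4, hx2, hxw⟩ := exists_fourth_root (hp.lam_pos hθ)
  obtain ⟨y, hy, hy4, hy2, hyw⟩ := exists_fourth_root (hq.lam_pos hθ)
  have hpr := hp.snd_pos hθ
  have hqr := hq.snd_pos hθ
  simp only at hn1 hn2
  have hD : |lam θ p - lam θ q| = |x ^ 2 - y ^ 2| * (x ^ 2 + y ^ 2) := by
    rw [hx4, hy4, show x ^ 4 - y ^ 4 = (x ^ 2 - y ^ 2) * (x ^ 2 + y ^ 2) by ring, abs_mul,
      abs_of_pos (by positivity : 0 < x ^ 2 + y ^ 2)]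
  have hΔ : 0 < |lam θ p - lam θ q| := abs_pos.mpr (sub_ne_zero.mpr hne)
  rw [hx4] at hM1'
  rw [hy4] at hM2'
  rw [hx4, hy4] at hn1 hn2
  have hsum := near_root_sum_le hx hy hn1 hn2
  rw [hx2, hy2] at hm
  have hcM : ∀ z : ℝ, 0 < z → θ / 4 * M ^ 2 ≤ z ^ 4 → c * M ≤ z ^ 2 := by
    intro z hz h4
    refine le_of_sq_le_sq ?_ (by positivity)
    calc (c * M) ^ 2 = c * (c * M ^ 2) := by ring
      _ ≤ 1 * (θ / 4 * M ^ 2) := by gcongr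
      _ ≤ _ := by linarith
  have hxy : c * M ≤ x * y := by
    refine le_of_sq_le_sq ?_ (by positivity)
    calc (c * M) ^ 2 = (c * M) * (c * M) := by ring
      _ ≤ x ^ 2 * y ^ 2 := by gcongr; exacts [hcM x hx hM1', hcM y hy hM2']
      _ = _ := by ring
  have hm' : m ^ s ≤ 3 * (x * y) ^ s * |lam θ p - lam θ q| ^ (-s) := by
    rw [Real.rpow_neg hΔ.le, ← div_eq_mul_inv, le_div_iff₀ (by positivity), hD,
      Real.mul_rpow (by positivity) (by positivity), ← mul_assoc]
    calc _ ≤ 1 * (x ^ 2 + y ^ 2) ^ s := by gcongr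
      _ ≤ (3 * (x * y)) ^ s := by rw [one_mul]; gcongr
      _ = 3 ^ s * (x * y) ^ s := Real.mul_rpow (by norm_num) (by positivity)
      _ ≤ 3 ^ (1 : ℝ) * (x * y) ^ s := by gcongr; norm_num
      _ = _ := by rw [Real.rpow_one]
  have hpow : (x * y) ^ (-(1 - s)) ≤ c⁻¹ * M ^ (-(1 - s)) := by
    calc _ ≤ (c * M) ^ (-(1 - s)) :=
          Real.rpow_le_rpow_of_nonpos (by positivity) hxy (by linarith)
      _ = c ^ (-(1 - s)) * M ^ (-(1 - s)) := Real.mul_rpow hc.le hM.le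
      _ ≤ c ^ (-1 : ℝ) * M ^ (-(1 - s)) := by
          gcongr ?_ * _
          exact Real.rpow_le_rpow_of_exponent_ge hc hc1 (by linarith)
      _ = _ := by rw [Real.rpow_neg_one]
  unfold weight
  rw [hxw, hyw]
  have hxy0 : 0 < x * y := by positivity
  calc _ ≤ x⁻¹ * (p.2 : ℝ)⁻¹ * (y⁻¹ * (q.2 : ℝ)⁻¹) *
        (3 * (x * y) ^ s * |lam θ p - lam θ q| ^ (-s)) := by gcongr
    _ = 3 * ((x * y) ^ (-(1 - s))) * (((p.2 : ℝ) * q.2)⁻¹ * |lam θ p - lam θ q| ^ (-s)) := by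
        rw [show -(1 - s) = s - 1 by ring, Real.rpow_sub_one hxy0.ne']
        field_simp
    _ ≤ 3 * (c⁻¹ * M ^ (-(1 - s))) * (((p.2 : ℝ) * q.2)⁻¹ * |lam θ p - lam θ q| ^ (-s)) := by
        gcongr
    _ = _ := by ring

end OffDiagonal

section OffDiagonalTotal

variable {θ a b c N s κ Z : ℝ} {n : ℕ} {Q : Finset ((ℕ × ℕ) × (ℕ × ℕ))}
  {m : (ℕ × ℕ) × (ℕ × ℕ) → ℝ}

lemma weight_nonneg (hθ : 0 < θ) {p : ℕ × ℕ} (hp : Admissible θ p) : 0 ≤ weight θ p :=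
  mul_nonneg (Real.rpow_nonneg (hp.lam_pos hθ).le _) (by positivity)

lemma sum_inv_mul_inv_le (hθ : 0 < θ) (hN1 : 1 ≤ N) (hn : (n : ℝ) ≤ N) {P : Finset (ℕ × ℕ)}
    (hP : ∀ p ∈ P, Admissible θ p ∧ p.1 ≤ n ∧ (p.2 : ℝ) ≤ N) :
    ∑ p ∈ P, (p.1 : ℝ)⁻¹ * (p.2 : ℝ)⁻¹ ≤ (1 + Real.log N) ^ 2 := by
  have hL : 0 ≤ Real.log N := Real.log_nonneg hN1
  have h1 := sum_Icc_inv_le (n := n) hN1 hn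
  have h2 := sum_Icc_inv_le (n := ⌊N⌋₊) hN1 (Nat.floor_le (by linarith))
  calc _ ≤ ∑ p ∈ Icc 1 n ×ˢ Icc 1 ⌊N⌋₊, (p.1 : ℝ)⁻¹ * (p.2 : ℝ)⁻¹ := by
        refine sum_le_sum_of_subset_of_nonneg (fun p hp => ?_) fun p _ _ => by positivity
        obtain ⟨hp1, hp2, hp3⟩ := hP p hp
        exact mem_product.mpr ⟨mem_Icc.mpr ⟨hp1.1, hp2⟩,
          mem_Icc.mpr ⟨hp1.snd_one_le hθ, Nat.le_floor hp3⟩⟩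
    _ = (∑ j ∈ Icc 1 n, (j : ℝ)⁻¹) * (∑ j ∈ Icc 1 ⌊N⌋₊, (j : ℝ)⁻¹) := by
        rw [sum_mul_sum, sum_product]
    _ ≤ (1 + Real.log N) * (1 + Real.log N) := by gcongr
    _ = _ := by ring

lemma sum_far_le (hθ : 0 < θ) (hN1 : 1 ≤ N) (hn : (n : ℝ) ≤ N)
    (hadm : ∀ x ∈ Q, Admissible θ x.1 ∧ Admissible θ x.2)
    (hfst : ∀ x ∈ Q, x.1.1 ≤ n ∧ x.2.1 ≤ n)
    (hN : ∀ x ∈ Q, (x.1.2 : ℝ) ≤ N ∧ (x.2.2 : ℝ) ≤ N) :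
    ∑ x ∈ Q, ((x.1.1 : ℝ)⁻¹ * (x.1.2 : ℝ)⁻¹) * ((x.2.1 : ℝ)⁻¹ * (x.2.2 : ℝ)⁻¹) ≤
      (1 + Real.log N) ^ 4 := by
  have hL : 0 ≤ Real.log N := Real.log_nonneg hN1
  have h1 := sum_inv_mul_inv_le (P := Q.image Prod.fst) hθ hN1 hn (by
    intro p hp
    obtain ⟨x, hx, rfl⟩ := mem_image.mp hp
    exact ⟨(hadm x hx).1, (hfst x hx).1, (hN x hx).1⟩)
  have h2 := sum_inv_mul_inv_le (P := Q.image Prod.snd) hθ hN1 hn (by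
    intro p hp
    obtain ⟨x, hx, rfl⟩ := mem_image.mp hp
    exact ⟨(hadm x hx).2, (hfst x hx).2, (hN x hx).2⟩)
  calc _ ≤ ∑ x ∈ Q.image Prod.fst ×ˢ Q.image Prod.snd,
        ((x.1.1 : ℝ)⁻¹ * (x.1.2 : ℝ)⁻¹) * ((x.2.1 : ℝ)⁻¹ * (x.2.2 : ℝ)⁻¹) :=
        sum_le_sum_of_subset_of_nonneg (fun x hx => mem_product.mpr
          ⟨mem_image_of_mem _ hx, mem_image_of_mem _ hx⟩) fun p _ _ => by positivity
    _ = (∑ p ∈ Q.image Prod.fst, (p.1 : ℝ)⁻¹ * (p.2 : ℝ)⁻¹) *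
        (∑ p ∈ Q.image Prod.snd, (p.1 : ℝ)⁻¹ * (p.2 : ℝ)⁻¹) := by
        rw [sum_mul_sum, sum_product]
    _ ≤ (1 + Real.log N) ^ 2 * (1 + Real.log N) ^ 2 := by
        refine mul_le_mul h1 h2 (sum_nonneg fun p _ => by positivity) (by positivity)
    _ = _ := by ring

lemma off_diagonal_le (hirr : Irrational θ) (hθ : 0 < θ) (ha : 0 < a) (hb : 0 < b)
    (H : ∀ p : ℤ, ∀ q : ℕ, 0 < q → b * (q : ℝ) ^ (-a) ≤ |θ * q - p|)
    (hs : 0 < s) (hs1 : s ≤ 1) (has : a * s ≤ 1) (hκ : 0 ≤ κ) (hsκ : s + a * s = 1 + κ)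
    (hc : 0 < c) (hc1 : c ≤ 1) (hcθ : c ≤ θ / 4) (hN1 : 1 ≤ N) (hn : 2 * (n : ℝ) ≤ N)
    (hadm : ∀ x ∈ Q, Admissible θ x.1 ∧ Admissible θ x.2)
    (hfst : ∀ x ∈ Q, x.1.1 ≤ n ∧ x.2.1 ≤ n)
    (hN : ∀ x ∈ Q, (x.1.2 : ℝ) ≤ c * N ∧ (x.2.2 : ℝ) ≤ c * N)
    (hlam : ∀ x ∈ Q, lam θ x.1 ≤ N ∧ lam θ x.2 ≤ N)
    (hne : ∀ x ∈ Q, x.1 ≠ x.2) (hZ : 1 ≤ Z) (hm0 : ∀ x ∈ Q, 0 ≤ m x) (hmZ : ∀ x ∈ Q, m x ≤ Z)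
    (hmD : ∀ x ∈ Q, m x * |Real.sqrt (lam θ x.1) - Real.sqrt (lam θ x.2)| ≤ 1) :
    ∑ x ∈ Q, weight θ x.1 * weight θ x.2 * m x ≤
      Z ^ (1 - s) * ((4 / θ + 6 / c ^ 2 + 96 * (b / 2) ^ (-s) / c ^ 3) *
        (1 + Real.log N) ^ 5 * N ^ κ) := by
  have hL : 0 ≤ Real.log N := Real.log_nonneg hN1
  have hcN : c * N ≤ N := by nlinarith
  have hnN : (n : ℝ) ≤ N := by linarith [(Nat.cast_nonneg n : (0 : ℝ) ≤ n)]
  have hZs : 1 ≤ Z ^ (1 - s) := Real.one_le_rpow hZ (by linarith)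
  have hNκ : 1 ≤ N ^ κ := Real.one_le_rpow hN1 hκ
  have hL45 : (1 + Real.log N) ^ 4 ≤ (1 + Real.log N) ^ 5 :=
    pow_le_pow_right₀ (by linarith) (by norm_num)
  have hL45' : (1 + Real.log N) ^ 4 ≤ (1 + Real.log N) ^ 5 * N ^ κ :=
    hL45.trans (le_mul_of_one_le_right (by positivity) hNκ)
  set far : (ℕ × ℕ) × (ℕ × ℕ) → Prop := fun x =>
    2 * lam θ x.2 < lam θ x.1 ∨ 2 * lam θ x.1 < lam θ x.2
  set sp : (ℕ × ℕ) × (ℕ × ℕ) → Prop := fun x =>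
    ((Nat.gcd x.1.1 x.2.1 : ℕ) : ℝ) ≤ |lam θ x.1 - lam θ x.2|
  classical
  have hlow : ∀ x ∈ Q, weight θ x.1 * weight θ x.2 * m x ≤
      Z ^ (1 - s) * (weight θ x.1 * weight θ x.2 * m x) := fun x hx =>
    le_mul_of_one_le_left (mul_nonneg (mul_nonneg (weight_nonneg hθ (hadm x hx).1)
      (weight_nonneg hθ (hadm x hx).2)) (hm0 x hx)) hZs
  have hnear : ∀ x ∈ Q, ¬ far x → NearPair θ x := by
    intro x hx hf
    simp only [far, not_or, not_lt] at hf
    exact ⟨(hadm x hx).1, (hadm x hx).2, hf.1, hf.2⟩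
  have hlne : ∀ x ∈ Q, lam θ x.1 ≠ lam θ x.2 := fun x hx =>
    lam_ne_of_ne hirr (hadm x hx).1.1 (hne x hx)
  have h1 : ∑ x ∈ Q with far x, weight θ x.1 * weight θ x.2 * m x ≤
      Z ^ (1 - s) * (4 / θ * (1 + Real.log N) ^ 4) := by
    have hk : ∀ x ∈ Q.filter far, x ∈ Q := fun x hx => (mem_filter.mp hx).1
    have key := sum_far_le (Q := Q.filter far) hθ hN1 hnN (fun x hx => hadm x (hk x hx))
      (fun x hx => hfst x (hk x hx)) (fun x hx => ⟨(hN x (hk x hx)).1.trans hcN,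
        (hN x (hk x hx)).2.trans hcN⟩)
    calc _ ≤ ∑ x ∈ Q with far x, Z ^ (1 - s) * (4 / θ *
          (((x.1.1 : ℝ)⁻¹ * (x.1.2 : ℝ)⁻¹) * ((x.2.1 : ℝ)⁻¹ * (x.2.2 : ℝ)⁻¹))) := by
          refine sum_le_sum fun x hx => (hlow x (hk x hx)).trans ?_
          have := weight_mul_far_le hθ (hadm x (hk x hx)).1 (hadm x (hk x hx)).2
            (mem_filter.mp hx).2 (hmD x (hk x hx))
          gcongr
      _ ≤ _ := by
          rw [← mul_sum, ← mul_sum]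
          gcongr
  have h2 : ∑ x ∈ Q with ¬ far x ∧ sp x, weight θ x.1 * weight θ x.2 * m x ≤
      Z ^ (1 - s) * (3 * (2 / c ^ 2 * (1 + Real.log N) ^ 4)) := by
    have hk : ∀ x ∈ Q.filter (fun x => ¬ far x ∧ sp x), x ∈ Q := fun x hx => (mem_filter.mp hx).1
    have key := sum_near_spaced_le (Q := Q.filter (fun x => ¬ far x ∧ sp x)) hθ hc hc1 hcθ hN1 hnN
      (fun x hx => hnear x (hk x hx) (mem_filter.mp hx).2.1) (fun x hx => hfst x (hk x hx))
      (fun x hx => hN x (hk x hx)) (fun x hx => (mem_filter.mp hx).2.2) (fun x hx => by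
        have h1 := (hadm x (hk x hx)).1.lam_pos hθ
        have h2 := (hadm x (hk x hx)).2.lam_pos hθ
        have h3 := hlam x (hk x hx)
        rw [abs_le]
        constructor <;> linarith)
    calc _ ≤ ∑ x ∈ Q with ¬ far x ∧ sp x, Z ^ (1 - s) * (3 *
          (((x.1.2 : ℝ) * x.2.2)⁻¹ * |lam θ x.1 - lam θ x.2|⁻¹)) := by
          refine sum_le_sum fun x hx => (hlow x (hk x hx)).trans ?_
          have := weight_mul_near_le hθ (hnear x (hk x hx) (mem_filter.mp hx).2.1)
            (hlne x (hk x hx)) (hmD x (hk x hx))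
          gcongr
      _ ≤ _ := by
          rw [← mul_sum, ← mul_sum]
          gcongr
  have h3 : ∑ x ∈ Q with ¬ far x ∧ ¬ sp x, weight θ x.1 * weight θ x.2 * m x ≤
      Z ^ (1 - s) * (3 / c * (32 * (b / 2) ^ (-s) / c ^ 2 * (1 + Real.log N) ^ 5 * N ^ κ)) := by
    have hk : ∀ x ∈ Q.filter (fun x => ¬ far x ∧ ¬ sp x), x ∈ Q := fun x hx => (mem_filter.mp hx).1
    have key := sum_near_close_le (Q := Q.filter (fun x => ¬ far x ∧ ¬ sp x)) hθ ha hb H hs hs1 has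
      hκ hsκ hc hc1 hcθ hN1 hn
      (fun x hx => hnear x (hk x hx) (mem_filter.mp hx).2.1) (fun x hx => hfst x (hk x hx))
      (fun x hx => hN x (hk x hx)) (fun x hx => not_le.mp (mem_filter.mp hx).2.2)
      (fun x hx => hne x (hk x hx))
    calc _ ≤ ∑ x ∈ Q with ¬ far x ∧ ¬ sp x, Z ^ (1 - s) * (3 / c *
          (((max x.1.1 x.2.1 : ℕ) : ℝ) ^ (-(1 - s)) *
          (((x.1.2 : ℝ) * x.2.2)⁻¹ * |lam θ x.1 - lam θ x.2| ^ (-s)))) := by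
          refine sum_le_sum fun x hx => ?_
          have hx' := hk x hx
          have hm := hm0 x hx'
          have h4 : m x ^ s * |Real.sqrt (lam θ x.1) - Real.sqrt (lam θ x.2)| ^ s ≤ 1 := by
            rw [← Real.mul_rpow hm (abs_nonneg _)]
            exact Real.rpow_le_one (by positivity) (hmD x hx') hs.le
          have := weight_mul_close_le hθ (hnear x hx' (mem_filter.mp hx).2.1)
            (hlne x hx') hs hs1 hc hc1 hcθ h4
          have hw1 := weight_nonneg hθ (hadm x hx').1
          have hw2 := weight_nonneg hθ (hadm x hx').2
          have h5 : m x ≤ Z ^ (1 - s) * m x ^ s := by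
            rcases hm.eq_or_lt with h0 | h0
            · rw [← h0]; positivity
            calc m x = m x ^ (1 - s) * m x ^ s := by
                  rw [← Real.rpow_add h0]; simp
              _ ≤ _ := by
                  have := hmZ x hx'
                  gcongr
          calc _ ≤ weight θ x.1 * weight θ x.2 * (Z ^ (1 - s) * m x ^ s) := by gcongr
            _ = Z ^ (1 - s) * (weight θ x.1 * weight θ x.2 * m x ^ s) := by ring
            _ ≤ _ := by gcongr
      _ ≤ _ := by
          rw [← mul_sum, ← mul_sum]
          gcongr
  have hsplit : ∑ x ∈ Q, weight θ x.1 * weight θ x.2 * m x =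
      ∑ x ∈ Q with far x, weight θ x.1 * weight θ x.2 * m x +
      (∑ x ∈ Q with ¬ far x ∧ sp x, weight θ x.1 * weight θ x.2 * m x +
      ∑ x ∈ Q with ¬ far x ∧ ¬ sp x, weight θ x.1 * weight θ x.2 * m x) := by
    rw [← filter_filter, ← filter_filter, sum_filter_add_sum_filter_not,
      sum_filter_add_sum_filter_not]
  rw [hsplit]
  calc _ ≤ _ := add_le_add h1 (add_le_add h2 h3)
    _ ≤ Z ^ (1 - s) * (4 / θ * ((1 + Real.log N) ^ 5 * N ^ κ)) +
        (Z ^ (1 - s) * (3 * (2 / c ^ 2 * ((1 + Real.log N) ^ 5 * N ^ κ))) +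
        Z ^ (1 - s) * (3 / c * (32 * (b / 2) ^ (-s) / c ^ 2 * (1 + Real.log N) ^ 5 * N ^ κ))) := by
        gcongr
    _ = _ := by
        field_simp
        ring

end OffDiagonalTotal

section Oscillatory

lemma abs_integral_pow_mul_cos_le {k : ℕ} (hk : 0 < k) {T c : ℝ} (hT : 0 < T) (hc : 0 < c)
    (φ : ℝ) :
    |∫ x in T..(2 * T), x ^ k * (Real.sqrt x)⁻¹ * Real.cos (c * Real.sqrt x + φ)| ≤
      4 * (2 * T) ^ k / c := by
  have hT2 : T ≤ 2 * T := by linarith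
  have hpos : ∀ x ∈ Set.uIcc T (2 * T), 0 < x := fun x hx => by
    rw [Set.uIcc_of_le hT2] at hx; exact hT.trans_le hx.1
  have hder : ∀ x ∈ Set.uIcc T (2 * T),
      HasDerivAt (fun x : ℝ => 2 / c * (x ^ k * Real.sin (c * Real.sqrt x + φ)))
        (2 / c * (k * x ^ (k - 1) * Real.sin (c * Real.sqrt x + φ)) +
          x ^ k * (Real.sqrt x)⁻¹ * Real.cos (c * Real.sqrt x + φ)) x := by
    intro x hx
    have hx0 := hpos x hx
    have hs := Real.sqrt_pos.mpr hx0
    have h1 := ((((Real.hasDerivAt_sqrt hx0.ne').const_mul c).add_const φ).sin)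
    have h2 := ((hasDerivAt_pow k x).mul h1).const_mul (2 / c)
    refine h2.congr_deriv ?_
    field_simp
  have hcs : ContinuousOn (fun x : ℝ => c * Real.sqrt x + φ) (Set.uIcc T (2 * T)) := by fun_prop
  have hi1 : IntervalIntegrable (fun x : ℝ =>
      2 / c * (k * x ^ (k - 1) * Real.sin (c * Real.sqrt x + φ)))
      MeasureTheory.volume T (2 * T) := by
    refine ContinuousOn.intervalIntegrable ?_
    fun_prop
  have hi2 : IntervalIntegrable (fun x : ℝ =>
      x ^ k * (Real.sqrt x)⁻¹ * Real.cos (c * Real.sqrt x + φ)) MeasureTheory.volume T (2 * T) := by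
    refine ContinuousOn.intervalIntegrable ?_
    have : ContinuousOn (fun x : ℝ => (Real.sqrt x)⁻¹) (Set.uIcc T (2 * T)) :=
      Real.continuous_sqrt.continuousOn.inv₀ fun x hx => (Real.sqrt_pos.mpr (hpos x hx)).ne'
    fun_prop
  have hFTC := intervalIntegral.integral_eq_sub_of_hasDerivAt hder (hi1.add hi2)
  rw [intervalIntegral.integral_add hi1 hi2] at hFTC
  have hbound : |∫ x in T..(2 * T), 2 / c * (k * x ^ (k - 1) * Real.sin (c * Real.sqrt x + φ))| ≤
      2 / c * ((2 * T) ^ k - T ^ k) := by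
    have hint : ∫ x in T..(2 * T), 2 / c * (k * x ^ (k - 1)) = 2 / c * ((2 * T) ^ k - T ^ k) := by
      rw [intervalIntegral.integral_const_mul]
      congr 1
      exact intervalIntegral.integral_eq_sub_of_hasDerivAt (fun x _ => hasDerivAt_pow k x)
        (Continuous.intervalIntegrable (by fun_prop) _ _)
    rw [← hint]
    refine intervalIntegral.norm_integral_le_of_norm_le (f := fun x : ℝ =>
      2 / c * (k * x ^ (k - 1) * Real.sin (c * Real.sqrt x + φ))) hT2 (Filter.Eventually.of_forall
      fun x hx => ?_) (Continuous.intervalIntegrable (by fun_prop) _ _)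
    have hx0 : 0 < x := hT.trans hx.1
    rw [Real.norm_eq_abs, abs_mul, abs_mul, abs_of_pos (by positivity : 0 < 2 / c),
      abs_of_nonneg (by positivity : 0 ≤ k * x ^ (k - 1))]
    have := Real.abs_sin_le_one (c * Real.sqrt x + φ)
    refine mul_le_mul_of_nonneg_left ?_ (by positivity)
    exact mul_le_of_le_one_right (by positivity) this
  have hF : ∀ x : ℝ, 0 < x →
      |2 / c * (x ^ k * Real.sin (c * Real.sqrt x + φ))| ≤ 2 / c * x ^ k := by
    intro x hx
    rw [abs_mul, abs_mul, abs_of_pos (by positivity : 0 < 2 / c),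
      abs_of_pos (by positivity : 0 < x ^ k)]
    exact mul_le_mul_of_nonneg_left
      (mul_le_of_le_one_right (by positivity) (Real.abs_sin_le_one _)) (by positivity)
  have h1 := abs_le.mp (hF T hT)
  have h2 := abs_le.mp (hF (2 * T) (by linarith))
  have h3 := abs_le.mp hbound
  have e : 4 * (2 * T) ^ k / c = 2 / c * (2 * T) ^ k + 2 / c * (2 * T) ^ k := by ring
  rw [e, abs_le]
  rw [mul_sub] at h3
  constructor <;> linarith

lemma abs_integral_pow_mul_le {k : ℕ} {T : ℝ} (hT : 0 < T) {f : ℝ → ℝ} (hf : ∀ x, |f x| ≤ 1) :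
    |∫ x in T..(2 * T), x ^ k * (Real.sqrt x)⁻¹ * f x| ≤ (2 * T) ^ k * Real.sqrt T := by
  have h := intervalIntegral.norm_integral_le_of_norm_le_const
    (f := fun x => x ^ k * (Real.sqrt x)⁻¹ * f x) (a := T) (b := 2 * T)
    (C := (2 * T) ^ k * (Real.sqrt T)⁻¹) (fun x hx => by
      rw [Set.uIoc_of_le (by linarith)] at hx
      have hx0 : 0 < x := hT.trans hx.1
      have := Real.sqrt_pos.mpr hT
      have := Real.sqrt_pos.mpr hx0
      rw [Real.norm_eq_abs, abs_mul, abs_of_nonneg (by positivity : 0 ≤ x ^ k * (Real.sqrt x)⁻¹)]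
      refine (mul_le_of_le_one_right (by positivity) (hf x)).trans ?_
      have := hx.2
      have := hx.1.le
      gcongr)
  have hs := Real.sqrt_pos.mpr hT
  refine h.trans (le_of_eq ?_)
  rw [show 2 * T - T = T by ring, abs_of_pos hT]
  have h2 := Real.sq_sqrt hT.le
  field_simp
  rw [h2]

/-- The phase attached to the frequency `t`. -/
noncomputable def phase (t x : ℝ) : ℝ := 2 * Real.pi * Real.sqrt (x * t) - Real.pi / 4

/-- The correlation of two oscillating terms over `[T, 2T]`. -/
noncomputable def correlation (k : ℕ) (T t u : ℝ) : ℝ :=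
  ∫ x in T..(2 * T), x ^ k * (Real.sqrt x)⁻¹ * (Real.cos (phase t x) * Real.cos (phase u x))

variable {k : ℕ} {T t u : ℝ}

lemma continuousOn_pow_mul_inv_sqrt (hT : 0 < T) :
    ContinuousOn (fun x : ℝ => x ^ k * (Real.sqrt x)⁻¹) (Set.uIcc T (2 * T)) := by
  have : ContinuousOn (fun x : ℝ => (Real.sqrt x)⁻¹) (Set.uIcc T (2 * T)) :=
    Real.continuous_sqrt.continuousOn.inv₀ fun x hx => by
      rw [Set.uIcc_of_le (by linarith)] at hx
      exact (Real.sqrt_pos.mpr (hT.trans_le hx.1)).ne'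
  fun_prop

lemma continuous_phase (t : ℝ) : Continuous (phase t) := by unfold phase; fun_prop

lemma correlation_comm : correlation k T t u = correlation k T u t := by
  unfold correlation
  simp only [mul_comm (Real.cos (phase t _))]

lemma correlation_eq (hT : 0 < T) : correlation k T t u =
    1 / 2 * (∫ x in T..(2 * T), x ^ k * (Real.sqrt x)⁻¹ *
      Real.cos (2 * Real.pi * (Real.sqrt t - Real.sqrt u) * Real.sqrt x + 0)) +
    1 / 2 * (∫ x in T..(2 * T), x ^ k * (Real.sqrt x)⁻¹ *
      Real.cos (2 * Real.pi * (Real.sqrt t + Real.sqrt u) * Real.sqrt x + -(Real.pi / 2))) := by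
  have hc := continuousOn_pow_mul_inv_sqrt (k := k) hT
  have hi : ∀ c φ : ℝ, IntervalIntegrable (fun x : ℝ => x ^ k * (Real.sqrt x)⁻¹ *
      Real.cos (c * Real.sqrt x + φ)) MeasureTheory.volume T (2 * T) := fun c φ =>
    ContinuousOn.intervalIntegrable (hc.mul (by fun_prop))
  rw [← intervalIntegral.integral_const_mul, ← intervalIntegral.integral_const_mul,
    ← intervalIntegral.integral_add ((hi _ _).const_mul _) ((hi _ _).const_mul _)]
  unfold correlation
  refine intervalIntegral.integral_congr fun x hx => ?_
  rw [Set.uIcc_of_le (by linarith)] at hx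
  have hx0 : 0 ≤ x := hT.le.trans hx.1
  simp only [phase]
  have h1 : 2 * Real.pi * (Real.sqrt t - Real.sqrt u) * Real.sqrt x + 0 =
      (2 * Real.pi * Real.sqrt (x * t) - Real.pi / 4) -
        (2 * Real.pi * Real.sqrt (x * u) - Real.pi / 4) := by
    rw [Real.sqrt_mul hx0, Real.sqrt_mul hx0]; ring
  have h2 : 2 * Real.pi * (Real.sqrt t + Real.sqrt u) * Real.sqrt x + -(Real.pi / 2) =
      (2 * Real.pi * Real.sqrt (x * t) - Real.pi / 4) +
        (2 * Real.pi * Real.sqrt (x * u) - Real.pi / 4) := by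
    rw [Real.sqrt_mul hx0, Real.sqrt_mul hx0]; ring
  rw [h1, h2]
  generalize 2 * Real.pi * Real.sqrt (x * t) - Real.pi / 4 = A
  generalize 2 * Real.pi * Real.sqrt (x * u) - Real.pi / 4 = B
  rw [Real.cos_sub, Real.cos_add]
  ring

lemma abs_correlation_le_sqrt (hT : 0 < T) :
    |correlation k T t u| ≤ (2 * T) ^ k * Real.sqrt T := by
  refine abs_integral_pow_mul_le hT fun x => ?_
  rw [abs_mul]
  exact mul_le_one₀ (Real.abs_cos_le_one _) (abs_nonneg _) (Real.abs_cos_le_one _)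

lemma abs_correlation_mul_le_of_lt (hk : 0 < k) (hT : 0 < T) (hu : 0 < u) (hut : u < t) :
    |correlation k T t u| * |Real.sqrt t - Real.sqrt u| ≤ (2 * T) ^ k := by
  have hsu := Real.sqrt_pos.mpr hu
  have hd : 0 < Real.sqrt t - Real.sqrt u := sub_pos.mpr (Real.sqrt_lt_sqrt hu.le hut)
  have hpi := Real.pi_gt_three
  have h1 := abs_integral_pow_mul_cos_le hk hT
    (by positivity : 0 < 2 * Real.pi * (Real.sqrt t - Real.sqrt u)) 0
  have h2 := abs_integral_pow_mul_cos_le hk hT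
    (by positivity : 0 < 2 * Real.pi * (Real.sqrt t + Real.sqrt u)) (-(Real.pi / 2))
  have h3 : ∀ d : ℝ, Real.sqrt t - Real.sqrt u ≤ d → 4 * (2 * T) ^ k / (2 * Real.pi * d) ≤
      (2 * T) ^ k / (Real.sqrt t - Real.sqrt u) := by
    intro d hd'
    have hd0 : 0 < d := hd.trans_le hd'
    rw [div_le_div_iff₀ (by positivity) hd]
    have : 0 < (2 * T) ^ k := by positivity
    calc 4 * (2 * T) ^ k * (Real.sqrt t - Real.sqrt u) = (2 * T) ^ k * (2 * 2 *
          (Real.sqrt t - Real.sqrt u)) := by ring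
      _ ≤ (2 * T) ^ k * (2 * Real.pi * d) := by gcongr; linarith
  rw [abs_of_pos hd, ← le_div_iff₀ hd, correlation_eq hT]
  have a1 := h1.trans (h3 _ le_rfl)
  have a2 := h2.trans (h3 _ (by linarith))
  rw [abs_le] at a1 a2 ⊢
  constructor <;> linarith

lemma abs_correlation_mul_le (hk : 0 < k) (hT : 0 < T) (ht : 0 < t) (hu : 0 < u) :
    |correlation k T t u| * |Real.sqrt t - Real.sqrt u| ≤ (2 * T) ^ k := by
  rcases lt_trichotomy t u with h | h | h
  · rw [correlation_comm, abs_sub_comm]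
    exact abs_correlation_mul_le_of_lt hk hT ht h
  · rw [h, sub_self, abs_zero, mul_zero]; positivity
  · exact abs_correlation_mul_le_of_lt hk hT hu h

lemma abs_correlation_self_sub_le (hk : 0 < k) (hT : 0 < T) (ht : 0 < t) :
    |correlation k T t t - 1 / 2 * ∫ x in T..(2 * T), x ^ k * (Real.sqrt x)⁻¹| ≤
      (2 * T) ^ k * (Real.sqrt t)⁻¹ := by
  have hst := Real.sqrt_pos.mpr ht
  have hpi := Real.pi_gt_three
  have h2 := abs_integral_pow_mul_cos_le hk hT
    (by positivity : 0 < 2 * Real.pi * (Real.sqrt t + Real.sqrt t)) (-(Real.pi / 2))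
  rw [correlation_eq hT]
  simp only [sub_self, mul_zero, zero_mul, add_zero, Real.cos_zero, mul_one]
  rw [add_sub_cancel_left, abs_mul, abs_of_pos (by norm_num : (0 : ℝ) < 1 / 2)]
  have h3 : 4 * (2 * T) ^ k / (2 * Real.pi * (Real.sqrt t + Real.sqrt t)) ≤
      (2 * T) ^ k * (Real.sqrt t)⁻¹ := by
    rw [← div_eq_mul_inv, div_le_div_iff₀ (by positivity) hst]
    have : 0 < (2 * T) ^ k := by positivity
    nlinarith [mul_pos this hst]
  have := abs_nonneg (∫ x in T..(2 * T), x ^ k * (Real.sqrt x)⁻¹ *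
      Real.cos (2 * Real.pi * (Real.sqrt t + Real.sqrt t) * Real.sqrt x + -(Real.pi / 2)))
  linarith

end Oscillatory

section Expansion

/-- The pairs `(h, r)` over which `R11` is summed. -/
noncomputable def pairs (θ T : ℝ) : Finset (ℕ × ℕ) :=
  ((Icc 1 ⌊T ^ 2⌋₊).sigma fun h =>
    Ioc ⌊θ * h⌋₊ ⌊θ * h * (2 ^ (2 * Jdef T + 1) + 1 / 2)⌋₊).image fun x => (x.1, x.2)

variable {l : ℕ} {θ T x : ℝ} {p : ℕ × ℕ}

lemma mem_pairs : p ∈ pairs θ T ↔ p.1 ∈ Icc 1 ⌊T ^ 2⌋₊ ∧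
    p.2 ∈ Ioc ⌊θ * p.1⌋₊ ⌊θ * p.1 * (2 ^ (2 * Jdef T + 1) + 1 / 2)⌋₊ := by
  unfold pairs
  rw [mem_image]
  constructor
  · rintro ⟨y, hy, rfl⟩
    exact mem_sigma.mp hy
  · exact fun h => ⟨⟨p.1, p.2⟩, mem_sigma.mpr h, rfl⟩

lemma admissible_of_mem_pairs (hθ : 0 < θ) (hp : p ∈ pairs θ T) : Admissible θ p := by
  obtain ⟨h1, h2⟩ := mem_pairs.mp hp
  exact ⟨(mem_Icc.mp h1).1, (Nat.floor_lt (by positivity)).mp (mem_Ioc.mp h2).1⟩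

lemma R11_eq (l : ℕ) (θ T x : ℝ) : R11 l θ T x (T ^ 2) =
    ((2 : ℝ) ^ ((2 : ℤ) - l) / ((l - 1).factorial * Real.pi)) * x ^ ((l : ℝ) - 1 / 4) *
      ∑ p ∈ pairs θ T, uCoef l θ p.1 p.2 * Real.cos (phase (lam θ p) x) := by
  unfold R11
  rw [sum_finset_product (pairs θ T) (Icc 1 ⌊T ^ 2⌋₊)
    (fun h => Ioc ⌊θ * h⌋₊ ⌊θ * h * (2 ^ (2 * Jdef T + 1) + 1 / 2)⌋₊) fun p => mem_pairs]
  simp only [phase, lam, mul_assoc]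

lemma integral_R11_sq (hT : 0 < T) : ∫ x in T..(2 * T), (R11 l θ T x (T ^ 2)) ^ 2 =
    ((2 : ℝ) ^ ((2 : ℤ) - l) / ((l - 1).factorial * Real.pi)) ^ 2 *
      ∑ y ∈ pairs θ T ×ˢ pairs θ T, uCoef l θ y.1.1 y.1.2 * uCoef l θ y.2.1 y.2.2 *
        correlation (2 * l) T (lam θ y.1) (lam θ y.2) := by
  have hc := continuousOn_pow_mul_inv_sqrt (k := 2 * l) hT
  unfold correlation
  simp only [← intervalIntegral.integral_const_mul]
  rw [← intervalIntegral.integral_finsetSum, ← intervalIntegral.integral_const_mul]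
  · refine intervalIntegral.integral_congr fun x hx => ?_
    rw [Set.uIcc_of_le (by linarith)] at hx
    have hx0 : 0 < x := hT.trans_le hx.1
    have hpow : (x ^ ((l : ℝ) - 1 / 4)) ^ 2 = x ^ (2 * l) * (Real.sqrt x)⁻¹ := by
      rw [← Real.rpow_natCast, ← Real.rpow_mul hx0.le, ← Real.rpow_natCast x, Real.sqrt_eq_rpow,
        ← Real.rpow_neg hx0.le, ← Real.rpow_add hx0]
      congr 1
      push_cast
      ring
    rw [R11_eq, mul_pow, mul_pow, hpow, sq (∑ p ∈ pairs θ T, _), sum_mul_sum, ← sum_product',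
      mul_assoc, mul_sum]
    congr 1
    refine sum_congr rfl fun y _ => ?_
    ring
  · intro y _
    refine (ContinuousOn.intervalIntegrable ?_).const_mul _
    exact hc.mul ((Real.continuous_cos.comp (continuous_phase _)).mul
      (Real.continuous_cos.comp (continuous_phase _))).continuousOn

lemma Admissible.snd_le_two_mul_sub (hp : Admissible θ p) : (p.2 : ℝ) ≤ 2 * p.2 - θ * p.1 := by
  linarith [hp.2]

lemma Admissible.ratio_mem (hθ : 0 < θ) (hp : Admissible θ p) :
    0 ≤ 1 - θ * p.1 / (2 * (p.2 : ℝ) - θ * p.1) ∧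
      1 - θ * p.1 / (2 * (p.2 : ℝ) - θ * p.1) ≤ 1 := by
  have h1 := hp.snd_le_two_mul_sub
  have h2 := hp.snd_pos hθ
  have h3 : 0 < 2 * (p.2 : ℝ) - θ * p.1 := h2.trans_le h1
  constructor
  · rw [sub_nonneg, div_le_one h3]
    linarith [hp.2]
  · have : 0 ≤ θ * p.1 / (2 * (p.2 : ℝ) - θ * p.1) := by positivity
    linarith

lemma abs_uCoef_le_weight (hθ : 0 < θ) (hp : Admissible θ p) :
    |uCoef l θ p.1 p.2| ≤ weight θ p := by
  have h1 := hp.snd_le_two_mul_sub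
  have h2 := hp.snd_pos hθ
  have h3 : 0 < 2 * (p.2 : ℝ) - θ * p.1 := h2.trans_le h1
  have h4 : (0 : ℝ) < p.1 := by linarith [hp.fst_ge]
  obtain ⟨r0, r1⟩ := hp.ratio_mem hθ
  unfold uCoef weight lam
  set ρ := 2 * (p.2 : ℝ) - θ * p.1
  rw [abs_mul, abs_mul, abs_mul, abs_pow, abs_neg, abs_one, one_pow, one_mul,
    abs_of_nonneg (by positivity : 0 ≤ (p.1 : ℝ) ^ (-(1 : ℝ) / 4)),
    abs_of_nonneg (by positivity : 0 ≤ ρ ^ (-(5 : ℝ) / 4)), abs_of_nonneg (pow_nonneg r0 _)]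
  refine (mul_le_of_le_one_right (by positivity) (pow_le_one₀ r0 r1)).trans ?_
  rw [Real.mul_rpow h4.le h3.le, show (-(5 : ℝ) / 4) = -(1 / 4) + -1 by norm_num,
    Real.rpow_add h3, Real.rpow_neg_one, show (-(1 : ℝ) / 4) = -(1 / 4) by norm_num, ← mul_assoc]
  gcongr

lemma uCoef_sq (hl : 1 ≤ l) (hθ : 0 < θ) (hp : Admissible θ p) : uCoef l θ p.1 p.2 ^ 2 =
    (1 - θ * p.1 / (2 * (p.2 : ℝ) - θ * p.1)) ^ (2 * l - 2) *
      (p.1 : ℝ) ^ (-(1 : ℝ) / 2) * (2 * (p.2 : ℝ) - θ * p.1) ^ (-(5 : ℝ) / 2) := by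
  have h1 := hp.snd_le_two_mul_sub
  have h2 := hp.snd_pos hθ
  have h3 : 0 < 2 * (p.2 : ℝ) - θ * p.1 := h2.trans_le h1
  unfold uCoef
  rw [mul_pow, mul_pow, mul_pow, ← pow_mul, ← pow_mul, mul_comm (l * p.1), pow_mul, neg_one_sq,
    one_pow, one_mul, ← Real.rpow_natCast _ 2, ← Real.rpow_mul (by positivity),
    ← Real.rpow_natCast _ 2, ← Real.rpow_mul h3.le, show (l - 1) * 2 = 2 * l - 2 by omega]
  norm_num
  ring

end Expansion

section Tail

variable {l : ℕ} {θ T : ℝ} {p : ℕ × ℕ}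

lemma two_pow_Jdef_bounds (hT : 3 ≤ T) :
    (2 : ℝ) ^ (2 * Jdef T) ≤ T ∧ Real.sqrt T / 4 ≤ 2 ^ (2 * Jdef T + 1) := by
  have hT0 : 0 < T := by linarith
  have hlog : 1 ≤ Real.log T := by
    rw [Real.le_log_iff_exp_le hT0]
    linarith [Real.exp_one_lt_d9]
  have hll : 0 ≤ Real.log (Real.log T) := Real.log_nonneg hlog
  have hll' : Real.log (Real.log T) ≤ Real.log T := Real.log_le_self (by linarith)
  have h2 : 0 < Real.log 2 := Real.log_pos one_lt_two
  set y := (Real.log T - Real.log (Real.log T)) / (2 * Real.log 2) with hy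
  have hy0 : 0 ≤ y := div_nonneg (by linarith) (by positivity)
  have hyl : y * (2 * Real.log 2) = Real.log T - Real.log (Real.log T) := by
    rw [hy]; field_simp
  have hpow : ∀ n : ℕ, (2 : ℝ) ^ n = Real.exp (n * Real.log 2) := fun n => by
    rw [mul_comm, Real.exp_mul, Real.exp_log two_pos, Real.rpow_natCast]
  have hJ1 : (Jdef T : ℝ) ≤ y := Nat.floor_le hy0
  have hJ2 : y < Jdef T + 1 := Nat.lt_floor_add_one y
  constructor
  · calc (2 : ℝ) ^ (2 * Jdef T) = Real.exp (Jdef T * (2 * Real.log 2)) := by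
          rw [hpow]; push_cast; ring_nf
      _ ≤ Real.exp (Real.log T) := by
          refine Real.exp_le_exp.mpr ?_
          have := mul_le_mul_of_nonneg_right hJ1 (by positivity : 0 ≤ 2 * Real.log 2)
          linarith
      _ = T := Real.exp_log hT0
  · have h3 : T / Real.log T ≤ 2 * 2 ^ (2 * Jdef T + 1) := by
      calc T / Real.log T = Real.exp (y * (2 * Real.log 2)) := by
            rw [hyl, Real.exp_sub, Real.exp_log hT0, Real.exp_log (by linarith)]
        _ ≤ Real.exp ((Jdef T + 1) * (2 * Real.log 2)) := by gcongr
        _ = 2 ^ (2 * Jdef T + 2) := by rw [hpow]; push_cast; ring_nf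
        _ = _ := by ring
    have h4 : Real.log T ≤ 2 * Real.sqrt T := by
      have := Real.log_le_rpow_div hT0.le (by norm_num : (0 : ℝ) < 1 / 2)
      rw [← Real.sqrt_eq_rpow] at this
      linarith
    have hs := Real.sqrt_pos.mpr hT0
    have h5 : Real.sqrt T / 2 ≤ T / Real.log T := by
      rw [div_le_div_iff₀ (by norm_num) (by linarith)]
      nlinarith [Real.mul_self_sqrt hT0.le]
    linarith

lemma pairs_bounds (hθ : 0 < θ) (hT : 3 ≤ T) (hp : p ∈ pairs θ T) :
    p.1 ≤ ⌊T ^ 2⌋₊ ∧ (p.2 : ℝ) ≤ 3 * θ * T ^ 3 ∧ lam θ p ≤ 6 * θ * T ^ 5 := by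
  have hadm := admissible_of_mem_pairs hθ hp
  obtain ⟨h1, h2⟩ := mem_pairs.mp hp
  have h3 := (mem_Icc.mp h1).2
  have h4 : (p.1 : ℝ) ≤ T ^ 2 := (Nat.le_floor_iff (by positivity)).mp h3
  have h5 : (p.2 : ℝ) ≤ 3 * θ * T ^ 3 := by
    calc (p.2 : ℝ) ≤ θ * p.1 * (2 ^ (2 * Jdef T + 1) + 1 / 2) :=
          (Nat.le_floor_iff (by positivity)).mp (mem_Ioc.mp h2).2
      _ = θ * p.1 * (2 * 2 ^ (2 * Jdef T) + 1 / 2) := by ring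
      _ ≤ θ * T ^ 2 * (2 * T + T) := by
          have := (two_pow_Jdef_bounds hT).1
          gcongr
          linarith
      _ = _ := by ring
  refine ⟨h3, h5, (hadm.lam_le hθ).trans ?_⟩
  calc _ ≤ 2 * (T ^ 2 * (3 * θ * T ^ 3)) := by gcongr
    _ = _ := by ring

lemma not_mem_pairs (hθ : 0 < θ) (hp : Admissible θ p) (hnp : p ∉ pairs θ T) :
    T ^ 2 < p.1 ∨ θ * p.1 * 2 ^ (2 * Jdef T + 1) < p.2 := by
  by_contra! h
  refine hnp (mem_pairs.mpr ⟨mem_Icc.mpr ⟨hp.1, Nat.le_floor h.1⟩, mem_Ioc.mpr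
    ⟨(Nat.floor_lt (by positivity)).mpr hp.2, Nat.le_floor (h.2.trans ?_)⟩⟩)
  gcongr
  norm_num

/-- A summable majorant, up to constants, for the squares of the coefficients. -/
noncomputable def majorant (p : ℕ × ℕ) : ℝ :=
  (p.1 : ℝ) ^ (-(5 / 4) : ℝ) * (p.2 : ℝ) ^ (-(5 / 4) : ℝ)

lemma summable_majorant : Summable majorant :=
  have h : Summable fun n : ℕ => (n : ℝ) ^ (-(5 / 4) : ℝ) :=
    Real.summable_nat_rpow.mpr (by norm_num)
  h.mul_of_nonneg h (fun _ => by positivity) fun _ => by positivity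

lemma majorant_nonneg : 0 ≤ majorant p := by unfold majorant; positivity

lemma weight_sq_le (hθ : 0 < θ) (hp : Admissible θ p) :
    weight θ p ^ 2 ≤ (p.1 : ℝ) ^ (-(1 / 2) : ℝ) * ((p.1 : ℝ) / p.2) ^ (5 / 4 : ℝ) * majorant p := by
  have h1 : (0 : ℝ) < p.1 := by linarith [hp.fst_ge]
  have h2 := hp.snd_pos hθ
  have h3 := hp.mul_le_lam
  unfold weight majorant
  calc _ ≤ (((p.1 : ℝ) * p.2) ^ (-(1 / 4) : ℝ) * (p.2 : ℝ)⁻¹) ^ 2 := by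
        have := Real.rpow_le_rpow_of_nonpos (by positivity) h3
          (by norm_num : (-(1 / 4) : ℝ) ≤ 0)
        have := hp.lam_pos hθ
        gcongr
    _ = (p.1 : ℝ) ^ (-(1 / 2) : ℝ) * (p.2 : ℝ) ^ (-(5 / 2) : ℝ) := by
        rw [Real.mul_rpow h1.le h2.le, ← Real.rpow_neg_one (p.2 : ℝ), mul_assoc,
          ← Real.rpow_add h2, mul_pow, ← Real.rpow_natCast _ 2, ← Real.rpow_natCast _ 2,
          ← Real.rpow_mul h1.le, ← Real.rpow_mul h2.le]
        norm_num
    _ = _ := by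
        rw [Real.div_rpow h1.le h2.le, Real.rpow_neg h1.le (5 / 4), Real.rpow_neg h2.le (5 / 4),
          show (-(5 / 2) : ℝ) = -(5 / 4) + -(5 / 4) by norm_num, Real.rpow_add h2,
          Real.rpow_neg h2.le (5 / 4)]
        field_simp

lemma weight_sq_le_of_admissible (hθ : 0 < θ) (hp : Admissible θ p) :
    weight θ p ^ 2 ≤ θ⁻¹ ^ (5 / 4 : ℝ) * majorant p := by
  have h1 := hp.fst_ge
  have h2 := hp.snd_pos hθ
  have hm := majorant_nonneg (p := p)
  refine (weight_sq_le hθ hp).trans (mul_le_mul_of_nonneg_right ?_ hm)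
  have h3 : (p.1 : ℝ) / p.2 ≤ θ⁻¹ := by
    rw [← one_div, div_le_div_iff₀ h2 hθ]
    linarith [hp.2]
  calc _ ≤ 1 * θ⁻¹ ^ (5 / 4 : ℝ) := by
        gcongr
        exact Real.rpow_le_one_of_one_le_of_nonpos h1 (by norm_num)
    _ = _ := one_mul _

lemma weight_sq_le_of_not_mem (hθ : 0 < θ) (hT : 3 ≤ T) (hp : Admissible θ p)
    (hnp : p ∉ pairs θ T) :
    weight θ p ^ 2 ≤ 2 * θ⁻¹ ^ (5 / 4 : ℝ) * T ^ (-(1 / 4) : ℝ) * majorant p := by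
  have hT0 : 0 < T := by linarith
  have h1 := hp.fst_ge
  have h2 := hp.snd_pos hθ
  have hm := majorant_nonneg (p := p)
  refine (weight_sq_le hθ hp).trans (mul_le_mul_of_nonneg_right ?_ hm)
  have h3 : (p.1 : ℝ) / p.2 ≤ θ⁻¹ := by
    rw [← one_div, div_le_div_iff₀ h2 hθ]
    linarith [hp.2]
  have hTm : T ^ (-1 : ℝ) ≤ T ^ (-(1 / 4) : ℝ) :=
    Real.rpow_le_rpow_of_exponent_le (by linarith) (by norm_num)
  have h0 : 0 ≤ T ^ (-(1 / 4) : ℝ) := by positivity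
  rcases not_mem_pairs hθ hp hnp with h | h
  · calc _ ≤ (T ^ 2) ^ (-(1 / 2) : ℝ) * θ⁻¹ ^ (5 / 4 : ℝ) := by
          have := Real.rpow_le_rpow_of_nonpos (by positivity) h.le
            (by norm_num : (-(1 / 2) : ℝ) ≤ 0)
          gcongr
      _ = T ^ (-1 : ℝ) * θ⁻¹ ^ (5 / 4 : ℝ) := by
          rw [← Real.rpow_natCast, ← Real.rpow_mul hT0.le]; norm_num
      _ ≤ (2 * T ^ (-(1 / 4) : ℝ)) * θ⁻¹ ^ (5 / 4 : ℝ) := by gcongr; linarith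
      _ = _ := by ring
  · have hs := Real.sqrt_pos.mpr hT0
    have h4 : (p.1 : ℝ) / p.2 ≤ 4 * (θ⁻¹ * (Real.sqrt T)⁻¹) := by
      have h5 : θ * p.1 * (Real.sqrt T / 4) ≤ p.2 := by
        refine le_trans ?_ h.le
        have := (two_pow_Jdef_bounds hT).2
        gcongr
      rw [← mul_inv, ← div_eq_mul_inv, div_le_div_iff₀ h2 (by positivity)]
      linarith
    have h6 : (4 : ℝ) ^ (1 / 2 : ℝ) = 2 := by
      rw [show (4 : ℝ) = 2 ^ (2 : ℝ) by norm_num, ← Real.rpow_mul (by norm_num)]; norm_num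
    calc _ ≤ 1 * (((p.1 : ℝ) / p.2) ^ (3 / 4 : ℝ) * ((p.1 : ℝ) / p.2) ^ (1 / 2 : ℝ)) := by
          rw [← Real.rpow_add (by positivity), show (3 / 4 + 1 / 2 : ℝ) = 5 / 4 by norm_num]
          gcongr
          exact Real.rpow_le_one_of_one_le_of_nonpos h1 (by norm_num)
      _ ≤ 1 * (θ⁻¹ ^ (3 / 4 : ℝ) * (4 * (θ⁻¹ * (Real.sqrt T)⁻¹)) ^ (1 / 2 : ℝ)) := by gcongr
      _ = _ := by
          have hi : 0 < θ⁻¹ := inv_pos.mpr hθ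
          rw [Real.mul_rpow (by norm_num) (by positivity), Real.mul_rpow hi.le (by positivity), h6,
            Real.inv_rpow hs.le, Real.sqrt_eq_rpow, ← Real.rpow_mul hT0.le,
            show (5 / 4 : ℝ) = 3 / 4 + 1 / 2 by norm_num, Real.rpow_add hi, Real.rpow_neg hT0.le]
          norm_num
          ring

open Classical in
/-- The general term of the series `Cconst`. -/
noncomputable def cTerm (l : ℕ) (θ : ℝ) (p : ℕ × ℕ) : ℝ :=
  if 1 ≤ p.1 ∧ 1 ≤ p.2 ∧ θ * p.1 < (p.2 : ℝ) then
    (1 - θ * p.1 / (2 * (p.2 : ℝ) - θ * p.1)) ^ (2 * l - 2) *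
      (p.1 : ℝ) ^ (-(1 : ℝ) / 2) * (2 * (p.2 : ℝ) - θ * p.1) ^ (-(5 : ℝ) / 2)
  else 0

lemma Cconst_eq_tsum : Cconst l θ = ∑' p, cTerm l θ p := rfl

lemma cTerm_of_admissible (hl : 1 ≤ l) (hθ : 0 < θ) (hp : Admissible θ p) :
    cTerm l θ p = uCoef l θ p.1 p.2 ^ 2 := by
  unfold cTerm
  rw [if_pos ⟨hp.1, hp.snd_one_le hθ, hp.2⟩, uCoef_sq hl hθ hp]

lemma cTerm_of_not_admissible (hp : ¬ Admissible θ p) : cTerm l θ p = 0 :=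
  if_neg fun h => hp ⟨h.1, h.2.2⟩

lemma cTerm_nonneg (hl : 1 ≤ l) (hθ : 0 < θ) : 0 ≤ cTerm l θ p := by
  by_cases hp : Admissible θ p
  · rw [cTerm_of_admissible hl hθ hp]; positivity
  · rw [cTerm_of_not_admissible hp]

lemma cTerm_le_weight_sq (hl : 1 ≤ l) (hθ : 0 < θ) (hp : Admissible θ p) :
    cTerm l θ p ≤ weight θ p ^ 2 := by
  rw [cTerm_of_admissible hl hθ hp]
  exact sq_le_sq' (by linarith [neg_abs_le (uCoef l θ p.1 p.2), abs_uCoef_le_weight (l := l) hθ hp])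
    ((le_abs_self _).trans (abs_uCoef_le_weight hθ hp))

lemma summable_cTerm (hl : 1 ≤ l) (hθ : 0 < θ) : Summable (cTerm l θ) := by
  refine Summable.of_nonneg_of_le (fun _ => cTerm_nonneg hl hθ) (fun p => ?_)
    (summable_majorant.mul_left (θ⁻¹ ^ (5 / 4 : ℝ)))
  by_cases hp : Admissible θ p
  · exact (cTerm_le_weight_sq hl hθ hp).trans (weight_sq_le_of_admissible hθ hp)
  · rw [cTerm_of_not_admissible hp]
    exact mul_nonneg (by positivity) majorant_nonneg

lemma abs_Cconst_sub_sum_le (hl : 1 ≤ l) (hθ : 0 < θ) (hT : 3 ≤ T) :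
    |∑ p ∈ pairs θ T, uCoef l θ p.1 p.2 ^ 2 - Cconst l θ| ≤
      2 * θ⁻¹ ^ (5 / 4 : ℝ) * T ^ (-(1 / 4) : ℝ) * ∑' p, majorant p := by
  have hT0 : 0 < T := by linarith
  have hsum : ∑ p ∈ pairs θ T, uCoef l θ p.1 p.2 ^ 2 = ∑ p ∈ pairs θ T, cTerm l θ p :=
    sum_congr rfl fun p hp => (cTerm_of_admissible hl hθ (admissible_of_mem_pairs hθ hp)).symm
  have hsplit := (summable_cTerm hl hθ).sum_add_tsum_compl (s := pairs θ T)
  have hC : 0 ≤ 2 * θ⁻¹ ^ (5 / 4 : ℝ) * T ^ (-(1 / 4) : ℝ) := by positivity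
  rw [hsum, Cconst_eq_tsum, ← hsplit, sub_add_cancel_left, abs_neg,
    abs_of_nonneg (tsum_nonneg fun _ => cTerm_nonneg hl hθ)]
  calc _ ≤ ∑' p : ↑((pairs θ T : Set (ℕ × ℕ))ᶜ),
        2 * θ⁻¹ ^ (5 / 4 : ℝ) * T ^ (-(1 / 4) : ℝ) * majorant p := by
        refine Summable.tsum_le_tsum (fun p => ?_) ((summable_cTerm hl hθ).subtype _)
          ((summable_majorant.mul_left _).subtype _)
        by_cases hp : Admissible θ (p : ℕ × ℕ)
        · exact (cTerm_le_weight_sq hl hθ hp).trans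
            (weight_sq_le_of_not_mem hθ hT hp fun h => p.2 (mem_coe.mpr h))
        · rw [cTerm_of_not_admissible hp]
          exact mul_nonneg hC majorant_nonneg
    _ ≤ ∑' p, 2 * θ⁻¹ ^ (5 / 4 : ℝ) * T ^ (-(1 / 4) : ℝ) * majorant p :=
        Summable.tsum_subtype_le _ _ (fun _ => mul_nonneg hC majorant_nonneg)
          (summable_majorant.mul_left _)
    _ = _ := tsum_mul_left

end Tail

section Assembly

variable {l : ℕ} {θ a b c s κ T N : ℝ} {p : ℕ × ℕ}

lemma weight_sq_mul_inv_sqrt_le (hθ : 0 < θ) (hp : Admissible θ p) :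
    weight θ p ^ 2 * (Real.sqrt (lam θ p))⁻¹ ≤ (p.1 : ℝ)⁻¹ * (p.2 : ℝ)⁻¹ := by
  obtain ⟨x, hx, hx4, hx2, hxw⟩ := exists_fourth_root (hp.lam_pos hθ)
  have h1 := hp.fst_ge
  have h2 := hp.snd_pos hθ
  have h3 : (1 : ℝ) ≤ p.2 := by exact_mod_cast hp.snd_one_le hθ
  have h4 := hp.mul_le_lam
  unfold weight
  rw [hxw, hx2]
  rw [hx4] at h4
  calc _ = (x ^ 4)⁻¹ * ((p.2 : ℝ)⁻¹) ^ 2 := by field_simp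
    _ ≤ ((p.1 : ℝ) * p.2)⁻¹ * 1 := by
        have h5 : (p.2 : ℝ)⁻¹ ≤ 1 := inv_le_one_of_one_le₀ h3
        have h6 : ((p.2 : ℝ)⁻¹) ^ 2 ≤ 1 := pow_le_one₀ (by positivity) h5
        gcongr
    _ = _ := by rw [mul_one, mul_inv]

lemma uCoef_sq_le_weight_sq (hθ : 0 < θ) (hp : Admissible θ p) :
    uCoef l θ p.1 p.2 ^ 2 ≤ weight θ p ^ 2 := by
  rw [← sq_abs]
  have := abs_uCoef_le_weight (l := l) hθ hp
  gcongr

lemma diagonal_le (hl : 1 ≤ l) (hθ : 0 < θ) (hT : 3 ≤ T) (hN1 : 1 ≤ N)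
    (hn : (⌊T ^ 2⌋₊ : ℝ) ≤ N) (hr : 3 * θ * T ^ 3 ≤ N) :
    |∑ p ∈ pairs θ T, uCoef l θ p.1 p.2 ^ 2 * correlation (2 * l) T (lam θ p) (lam θ p) -
      1 / 2 * (∫ x in T..(2 * T), x ^ (2 * l) * (Real.sqrt x)⁻¹) *
        ∑ p ∈ pairs θ T, uCoef l θ p.1 p.2 ^ 2| ≤ (2 * T) ^ (2 * l) * (1 + Real.log N) ^ 2 := by
  have hT0 : 0 < T := by linarith
  have hadm := fun p (hp : p ∈ pairs θ T) => admissible_of_mem_pairs hθ hp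
  rw [mul_sum, ← sum_sub_distrib]
  refine (abs_sum_le_sum_abs _ _).trans ?_
  have key := sum_inv_mul_inv_le (P := pairs θ T) hθ hN1 hn fun p hp =>
    ⟨hadm p hp, (pairs_bounds hθ hT hp).1, (pairs_bounds hθ hT hp).2.1.trans hr⟩
  calc _ ≤ ∑ p ∈ pairs θ T, (2 * T) ^ (2 * l) * ((p.1 : ℝ)⁻¹ * (p.2 : ℝ)⁻¹) := by
        refine sum_le_sum fun p hp => ?_
        rw [mul_comm (1 / 2 * _), ← mul_sub, abs_mul, abs_of_nonneg (sq_nonneg _)]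
        have h1 := abs_correlation_self_sub_le (k := 2 * l) (by omega) hT0
          ((hadm p hp).lam_pos hθ)
        have h2 := uCoef_sq_le_weight_sq (l := l) hθ (hadm p hp)
        have h3 := weight_sq_mul_inv_sqrt_le hθ (hadm p hp)
        calc _ ≤ weight θ p ^ 2 * ((2 * T) ^ (2 * l) * (Real.sqrt (lam θ p))⁻¹) := by gcongr
          _ = (2 * T) ^ (2 * l) * (weight θ p ^ 2 * (Real.sqrt (lam θ p))⁻¹) := by ring
          _ ≤ _ := by gcongr
    _ ≤ _ := by rw [← mul_sum]; gcongr

lemma off_diagonal_correlation_le (hl : 1 ≤ l) (hirr : Irrational θ) (hθ : 0 < θ) (ha : 0 < a)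
    (hb : 0 < b) (H : ∀ p : ℤ, ∀ q : ℕ, 0 < q → b * (q : ℝ) ^ (-a) ≤ |θ * q - p|)
    (hs : 0 < s) (hs1 : s ≤ 1) (has : a * s ≤ 1) (hκ : 0 ≤ κ) (hsκ : s + a * s = 1 + κ)
    (hc : 0 < c) (hc1 : c ≤ 1) (hcθ : c ≤ θ / 4) (hT : 3 ≤ T) (hN1 : 1 ≤ N)
    (hn : 2 * (⌊T ^ 2⌋₊ : ℝ) ≤ N) (hr : 3 * θ * T ^ 3 ≤ c * N) (hlam : 6 * θ * T ^ 5 ≤ N) :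
    |∑ y ∈ pairs θ T ×ˢ pairs θ T with y.1 ≠ y.2,
      uCoef l θ y.1.1 y.1.2 * uCoef l θ y.2.1 y.2.2 *
        correlation (2 * l) T (lam θ y.1) (lam θ y.2)| ≤
      (2 * T) ^ (2 * l) * (Real.sqrt T ^ (1 - s) *
        ((4 / θ + 6 / c ^ 2 + 96 * (b / 2) ^ (-s) / c ^ 3) * (1 + Real.log N) ^ 5 * N ^ κ)) := by
  have hT0 : 0 < T := by linarith
  have hV : 0 < (2 * T) ^ (2 * l) := by positivity
  set Q := (pairs θ T ×ˢ pairs θ T).filter (fun y => y.1 ≠ y.2)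
  have hk : ∀ y ∈ Q, y.1 ∈ pairs θ T ∧ y.2 ∈ pairs θ T ∧ y.1 ≠ y.2 := fun y hy => by
    obtain ⟨h1, h2⟩ := mem_filter.mp hy
    obtain ⟨h3, h4⟩ := mem_product.mp h1
    exact ⟨h3, h4, h2⟩
  have hb1 := fun y hy => pairs_bounds hθ hT (hk y hy).1
  have hb2 := fun y hy => pairs_bounds hθ hT (hk y hy).2.1
  have hadm : ∀ y ∈ Q, Admissible θ y.1 ∧ Admissible θ y.2 := fun y hy =>
    ⟨admissible_of_mem_pairs hθ (hk y hy).1, admissible_of_mem_pairs hθ (hk y hy).2.1⟩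
  have key := off_diagonal_le (Q := Q) (Z := Real.sqrt T) (m := fun y =>
      |correlation (2 * l) T (lam θ y.1) (lam θ y.2)| / (2 * T) ^ (2 * l)) hirr hθ ha hb H hs hs1
    has hκ hsκ hc hc1 hcθ hN1 hn hadm (fun y hy => ⟨(hb1 y hy).1, (hb2 y hy).1⟩)
    (fun y hy => ⟨(hb1 y hy).2.1.trans hr, (hb2 y hy).2.1.trans hr⟩)
    (fun y hy => ⟨(hb1 y hy).2.2.trans hlam, (hb2 y hy).2.2.trans hlam⟩)
    (fun y hy => (hk y hy).2.2) (Real.one_le_sqrt.mpr (by linarith))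
    (fun y _ => by positivity)
    (fun y _ => by
      rw [div_le_iff₀ hV, mul_comm (Real.sqrt T)]
      exact abs_correlation_le_sqrt hT0)
    (fun y hy => by
      rw [div_mul_eq_mul_div, div_le_one hV]
      exact abs_correlation_mul_le (by omega) hT0 ((hadm y hy).1.lam_pos hθ)
        ((hadm y hy).2.lam_pos hθ))
  refine (abs_sum_le_sum_abs _ _).trans ?_
  calc _ ≤ ∑ y ∈ Q, (2 * T) ^ (2 * l) * (weight θ y.1 * weight θ y.2 *
        (|correlation (2 * l) T (lam θ y.1) (lam θ y.2)| / (2 * T) ^ (2 * l))) := by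
        refine sum_le_sum fun y hy => ?_
        rw [abs_mul, abs_mul]
        have h1 := abs_uCoef_le_weight (l := l) hθ (hadm y hy).1
        have h2 := abs_uCoef_le_weight (l := l) hθ (hadm y hy).2
        have h3 := weight_nonneg hθ (hadm y hy).1
        calc _ ≤ weight θ y.1 * weight θ y.2 *
              |correlation (2 * l) T (lam θ y.1) (lam θ y.2)| := by gcongr
          _ = _ := by field_simp
    _ ≤ _ := by rw [← mul_sum]; gcongr

lemma integral_rpow_eq (hT : 0 < T) : ∫ x in T..(2 * T), x ^ (2 * (l : ℝ) - 1 / 2) =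
    ∫ x in T..(2 * T), x ^ (2 * l) * (Real.sqrt x)⁻¹ := by
  refine intervalIntegral.integral_congr fun x hx => ?_
  rw [Set.uIcc_of_le (by linarith)] at hx
  have hx0 : 0 < x := hT.trans_le hx.1
  rw [← Real.rpow_natCast x, Real.sqrt_eq_rpow, ← Real.rpow_neg hx0.le, ← Real.rpow_add hx0]
  congr 1
  push_cast
  ring

lemma coefficient_eq : (2 : ℝ) ^ ((3 : ℤ) - 2 * l) /
      (Real.pi ^ 2 * ((l - 1).factorial : ℝ) ^ 2) =
    ((2 : ℝ) ^ ((2 : ℤ) - l) / ((l - 1).factorial * Real.pi)) ^ 2 * (1 / 2) := by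
  rw [div_pow, ← zpow_natCast ((2 : ℝ) ^ ((2 : ℤ) - l)), ← zpow_mul,
    show (3 : ℤ) - 2 * l = ((2 : ℤ) - l) * (2 : ℕ) + -1 by push_cast; ring,
    zpow_add₀ two_ne_zero, zpow_neg_one]
  ring

lemma mean_square_sub_le (hl : 1 ≤ l) (hirr : Irrational θ) (hθ : 0 < θ) (ha : 0 < a)
    (hb : 0 < b) (H : ∀ p : ℤ, ∀ q : ℕ, 0 < q → b * (q : ℝ) ^ (-a) ≤ |θ * q - p|)
    (hs : 0 < s) (hs1 : s ≤ 1) (has : a * s ≤ 1) (hκ : 0 ≤ κ) (hsκ : s + a * s = 1 + κ)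
    (hc : 0 < c) (hc1 : c ≤ 1) (hcθ : c ≤ θ / 4) (hT : 3 ≤ T) (hN1 : 1 ≤ N)
    (hn : 2 * (⌊T ^ 2⌋₊ : ℝ) ≤ N) (hr : 3 * θ * T ^ 3 ≤ c * N) (hlam : 6 * θ * T ^ 5 ≤ N) :
    |(∫ x in T..(2 * T), (R11 l θ T x (T ^ 2)) ^ 2) -
          ((2 : ℝ) ^ ((3 : ℤ) - 2 * l) * Cconst l θ /
              (Real.pi ^ 2 * ((l - 1).factorial : ℝ) ^ 2)) *
            ∫ x in T..(2 * T), x ^ (2 * (l : ℝ) - 1 / 2)| ≤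
      ((2 : ℝ) ^ ((2 : ℤ) - l) / ((l - 1).factorial * Real.pi)) ^ 2 * (2 * T) ^ (2 * l) *
        ((1 + Real.log N) ^ 2 + Real.sqrt T ^ (1 - s) *
          ((4 / θ + 6 / c ^ 2 + 96 * (b / 2) ^ (-s) / c ^ 3) * (1 + Real.log N) ^ 5 * N ^ κ) +
        Real.sqrt T * (θ⁻¹ ^ (5 / 4 : ℝ) * T ^ (-(1 / 4) : ℝ) * ∑' p, majorant p)) := by
  have hT0 : 0 < T := by linarith
  have h1 := diagonal_le (l := l) hl hθ hT hN1
    (by linarith [(Nat.cast_nonneg ⌊T ^ 2⌋₊ : (0 : ℝ) ≤ _)])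
    (hr.trans (mul_le_of_le_one_left (by linarith) hc1))
  have h2 := off_diagonal_correlation_le hl hirr hθ ha hb H hs hs1 has hκ hsκ hc hc1 hcθ hT hN1
    hn hr hlam
  have h3 := abs_Cconst_sub_sum_le hl hθ hT
  have h4 : |∫ x in T..(2 * T), x ^ (2 * l) * (Real.sqrt x)⁻¹| ≤
      (2 * T) ^ (2 * l) * Real.sqrt T := by
    simpa using abs_integral_pow_mul_le (k := 2 * l) hT0 (f := fun _ => 1) (by simp)
  have hsplit : ∑ y ∈ pairs θ T ×ˢ pairs θ T, uCoef l θ y.1.1 y.1.2 * uCoef l θ y.2.1 y.2.2 *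
        correlation (2 * l) T (lam θ y.1) (lam θ y.2) =
      ∑ p ∈ pairs θ T, uCoef l θ p.1 p.2 ^ 2 * correlation (2 * l) T (lam θ p) (lam θ p) +
      ∑ y ∈ pairs θ T ×ˢ pairs θ T with y.1 ≠ y.2,
        uCoef l θ y.1.1 y.1.2 * uCoef l θ y.2.1 y.2.2 *
          correlation (2 * l) T (lam θ y.1) (lam θ y.2) := by
    rw [← sum_filter_add_sum_filter_not _ (fun y : (ℕ × ℕ) × (ℕ × ℕ) => y.1 = y.2)]
    congr 1
    rw [sum_filter, sum_product]
    refine sum_congr rfl fun p hp => ?_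
    simp only [sum_ite_eq, if_pos hp, sq]
  rw [integral_R11_sq hT0, hsplit, integral_rpow_eq hT0, mul_div_right_comm, coefficient_eq]
  set A := ((2 : ℝ) ^ ((2 : ℤ) - l) / ((l - 1).factorial * Real.pi)) ^ 2
  have hA : 0 ≤ A := sq_nonneg _
  set I := ∫ x in T..(2 * T), x ^ (2 * l) * (Real.sqrt x)⁻¹
  set S1 := ∑ p ∈ pairs θ T, uCoef l θ p.1 p.2 ^ 2 * correlation (2 * l) T (lam θ p) (lam θ p)
  set S2 := ∑ y ∈ pairs θ T ×ˢ pairs θ T with y.1 ≠ y.2,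
        uCoef l θ y.1.1 y.1.2 * uCoef l θ y.2.1 y.2.2 *
          correlation (2 * l) T (lam θ y.1) (lam θ y.2)
  set U := ∑ p ∈ pairs θ T, uCoef l θ p.1 p.2 ^ 2
  have e : A * (S1 + S2) - A * (1 / 2) * Cconst l θ * I =
      A * ((S1 - 1 / 2 * I * U) + S2 + 1 / 2 * (I * (U - Cconst l θ))) := by ring
  rw [e, abs_mul, abs_of_nonneg hA, mul_assoc A]
  refine mul_le_mul_of_nonneg_left ?_ hA
  have h5 := mul_le_mul h4 h3 (abs_nonneg _) (by positivity)
  rw [← abs_mul] at h5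
  have h6 := abs_add_three (S1 - 1 / 2 * I * U) S2 (1 / 2 * (I * (U - Cconst l θ)))
  rw [abs_mul (1 / 2), abs_of_pos (by norm_num : (0 : ℝ) < 1 / 2)] at h6
  refine h6.trans ?_
  rw [mul_add, mul_add]
  refine add_le_add (add_le_add h1 h2) ?_
  linarith

end Assembly

section Final

lemma one_add_log_pow_le {ε T : ℝ} (hε : 0 < ε) (hT : 1 ≤ T) :
    (1 + Real.log (T ^ 6)) ^ 5 ≤ (1 + 60 / ε) ^ 5 * T ^ (ε / 2) := by
  have hT0 : 0 < T := by linarith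
  have h1 := Real.log_le_rpow_div hT0.le (by positivity : 0 < ε / 10)
  have h2 : 1 ≤ T ^ (ε / 10) := Real.one_le_rpow hT (by positivity)
  have h3 : 0 ≤ Real.log T := Real.log_nonneg hT
  have h4 : T ^ (ε / 2) = (T ^ (ε / 10)) ^ 5 := by
    rw [← Real.rpow_natCast, ← Real.rpow_mul hT0.le]
    congr 1
    push_cast
    ring
  rw [h4, ← mul_pow, Real.log_pow]
  have h5 : (1 + 60 / ε) * T ^ (ε / 10) = T ^ (ε / 10) + 6 * (T ^ (ε / 10) / (ε / 10)) := by
    field_simp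
    ring
  rw [h5]
  push_cast
  gcongr

end Final

/-- Estimate (5.23), mean square of `R₁₁`: for `l ≥ 1` and irrational `θ > 0` of finite
approximation type `γ ≥ 1`, for every `ε > 0` there are `C > 0` and `T₀ ≥ 3` such that for
all `T ≥ T₀`, with `H = T²`:
`|∫_T^{2T} R₁₁(x,H)² dx − (2^{3−2l}·C_{l,θ}/(π²·((l−1)!)²))·∫_T^{2T} x^{2l−1/2} dx|
  ≤ C·T^{2l + 1/2 − 1/(2(1+γ)) + ε}`. -/
theorem R11_mean_square (l : ℕ) (hl : 1 ≤ l) (θ γ : ℝ) (hθ : 0 < θ)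
    (hirr : Irrational θ) (htype : IsApproxType θ γ) (ε : ℝ) (hε : 0 < ε) :
    ∃ C : ℝ, 0 < C ∧ ∃ T₀ : ℝ, 3 ≤ T₀ ∧ ∀ T : ℝ, T₀ ≤ T →
      |(∫ x in T..(2 * T), (R11 l θ T x (T ^ 2)) ^ 2) -
          ((2 : ℝ) ^ ((3 : ℤ) - 2 * l) * Cconst l θ /
              (Real.pi ^ 2 * ((l - 1).factorial : ℝ) ^ 2)) *
            ∫ x in T..(2 * T), x ^ (2 * (l : ℝ) - 1 / 2)| ≤
        C * T ^ (2 * (l : ℝ) + 1 / 2 - 1 / (2 * (1 + γ)) + ε) := by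
  have hγ : 1 ≤ γ := htype.1
  set s : ℝ := 1 / (1 + γ) with hs_def
  have hs : 0 < s := by positivity
  have hs2 : s ≤ 1 / 2 := one_div_le_one_div_of_le (by norm_num) (by linarith)
  have hsγ : (1 + γ) * s = 1 := by rw [hs_def]; field_simp
  obtain ⟨η, hη, hη1, hηε⟩ : ∃ η : ℝ, 0 < η ∧ η ≤ 1 ∧ 6 * η ≤ ε :=
    ⟨min 1 (ε / 6), lt_min one_pos (by positivity), min_le_left _ _, by
      linarith [min_le_right 1 (ε / 6)]⟩
  obtain ⟨b, hb, H⟩ := htype.exists_mul_sub_ge hη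
  obtain ⟨c, hc, hc1, hcθ⟩ : ∃ c : ℝ, 0 < c ∧ c ≤ 1 ∧ c ≤ θ / 4 :=
    ⟨min 1 (θ / 4), lt_min one_pos (by positivity), min_le_left _ _, min_le_right _ _⟩
  set K := 4 / θ + 6 / c ^ 2 + 96 * (b / 2) ^ (-s) / c ^ 3
  set S := θ⁻¹ ^ (5 / 4 : ℝ) * ∑' p, majorant p
  set A := ((2 : ℝ) ^ ((2 : ℤ) - l) / ((l - 1).factorial * Real.pi)) ^ 2
  have hS : 0 ≤ S := mul_nonneg (by positivity) (tsum_nonneg fun _ => majorant_nonneg)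
  have hK : 0 < K := by positivity
  have hA : 0 < A := by positivity
  refine ⟨A * 2 ^ (2 * l) * ((1 + 60 / ε) ^ 5 + (1 + 60 / ε) ^ 5 * K + S), by positivity,
    3 + 3 * θ / c + 6 * θ, by linarith [(by positivity : 0 ≤ 3 * θ / c)], fun T hT₀ => ?_⟩
  have hcθ0 : 0 < 3 * θ / c := by positivity
  have hT : 3 ≤ T := by linarith
  have hT1 : 1 ≤ T := by linarith
  have hT0 : 0 < T := by linarith
  have hTc : 3 * θ ≤ c * T := by
    rw [mul_comm c, ← div_le_iff₀ hc]
    linarith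
  have hn : 2 * (⌊T ^ 2⌋₊ : ℝ) ≤ T ^ 6 := by
    calc 2 * (⌊T ^ 2⌋₊ : ℝ) ≤ T * T ^ 2 := by
          gcongr
          · linarith
          · exact Nat.floor_le (by positivity)
      _ = T ^ 3 := by ring
      _ ≤ T ^ 6 := pow_le_pow_right₀ hT1 (by norm_num)
  have hr : 3 * θ * T ^ 3 ≤ c * T ^ 6 := by
    calc 3 * θ * T ^ 3 ≤ c * T * T ^ 3 := by gcongr
      _ = c * T ^ 4 := by ring
      _ ≤ c * T ^ 6 := mul_le_mul_of_nonneg_left (pow_le_pow_right₀ hT1 (by norm_num)) hc.le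
  have hlam : 6 * θ * T ^ 5 ≤ T ^ 6 := by
    calc 6 * θ * T ^ 5 ≤ T * T ^ 5 := by gcongr; linarith
      _ = T ^ 6 := by ring
  have main := mean_square_sub_le (a := γ + η) (s := s) (κ := η * s) (N := T ^ 6) hl hirr hθ
    (by positivity) hb H hs (by linarith) (by nlinarith) (by positivity) (by linarith) hc hc1 hcθ
    hT (one_le_pow₀ hT1) hn hr hlam
  refine main.trans ?_
  set E := T ^ (1 / 2 - s / 2 + ε) with hE
  have hlog := one_add_log_pow_le hε hT1
  have hL1 : 1 ≤ 1 + Real.log (T ^ 6) := by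
    linarith [Real.log_nonneg (one_le_pow₀ hT1 : 1 ≤ T ^ 6)]
  have hmono : ∀ u v : ℝ, u ≤ v → T ^ u ≤ T ^ v := fun u v =>
    Real.rpow_le_rpow_of_exponent_le hT1
  have t1 : (1 + Real.log (T ^ 6)) ^ 2 ≤ (1 + 60 / ε) ^ 5 * E :=
    calc _ ≤ (1 + Real.log (T ^ 6)) ^ 5 := pow_le_pow_right₀ hL1 (by norm_num)
      _ ≤ _ := hlog
      _ ≤ _ := mul_le_mul_of_nonneg_left (hmono _ _ (by linarith)) (by positivity)
  have t2 : Real.sqrt T ^ (1 - s) * (K * (1 + Real.log (T ^ 6)) ^ 5 * (T ^ 6) ^ (η * s)) ≤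
      (1 + 60 / ε) ^ 5 * K * E := by
    have h1 : Real.sqrt T ^ (1 - s) = T ^ (1 / 2 - s / 2) := by
      rw [Real.sqrt_eq_rpow, ← Real.rpow_mul hT0.le]
      congr 1
      ring
    have h2 : (T ^ 6) ^ (η * s) ≤ T ^ (ε / 2) := by
      rw [← Real.rpow_natCast, ← Real.rpow_mul hT0.le]
      refine hmono _ _ ?_
      push_cast
      nlinarith
    calc _ ≤ T ^ (1 / 2 - s / 2) * (K * ((1 + 60 / ε) ^ 5 * T ^ (ε / 2)) * T ^ (ε / 2)) := by
          rw [h1]; gcongr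
      _ = (1 + 60 / ε) ^ 5 * K * (T ^ (1 / 2 - s / 2) * T ^ (ε / 2) * T ^ (ε / 2)) := by ring
      _ = _ := by
          rw [← Real.rpow_add hT0, ← Real.rpow_add hT0, hE]
          congr 2
          ring
  have t3 : Real.sqrt T * (θ⁻¹ ^ (5 / 4 : ℝ) * T ^ (-(1 / 4) : ℝ) * ∑' p, majorant p) ≤ S * E := by
    calc _ = S * (T ^ (1 / 2 : ℝ) * T ^ (-(1 / 4) : ℝ)) := by rw [Real.sqrt_eq_rpow]; ring
      _ ≤ _ := by
          rw [← Real.rpow_add hT0]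
          exact mul_le_mul_of_nonneg_left (hmono _ _ (by linarith)) hS
  have hexp : T ^ (2 * (l : ℝ) + 1 / 2 - 1 / (2 * (1 + γ)) + ε) = T ^ (2 * l) * E := by
    rw [hE, ← Real.rpow_natCast T, ← Real.rpow_add hT0]
    congr 1
    have : 1 / (2 * (1 + γ)) = s / 2 := by rw [hs_def]; field_simp
    rw [this]
    push_cast
    ring
  rw [hexp]
  calc _ ≤ A * (2 * T) ^ (2 * l) * ((1 + 60 / ε) ^ 5 * E + (1 + 60 / ε) ^ 5 * K * E + S * E) := by
        gcongr
    _ = _ := by rw [mul_pow]; ring
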